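/- arXiv:1911.05336 — 4 statements merged into one kernel-verified Lean document; each statement's English description precedes it below -/
import Mathlib

section
/- Let ν be a finite complex Borel measure on the unit circle S¹ ⊂ ℂ such that ∫_{S¹} wⁿ dν(w) = 0 for every integer n ≥ 1 (equivalently, the Cauchy transform ν̂ vanishes at every point z with |z| > 1). Then ν is absolutely continuous with respect to arc-length (Lebesgue) measure on S¹. -/
open MeasureTheory Filter Set Metric Complex Topology
open scoped ENNReal NNReal

/-- A finite complex Borel measure on `ℂ`, given by its total variation measure
together with a unimodular density (polar decomposition `dν = density · d(var)`). -/
structure CMeasure where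
  var : Measure ℂ
  density : ℂ → ℂ
  finite : IsFiniteMeasure var
  meas_density : Measurable density
  norm_density : ∀ᵐ w ∂var, ‖density w‖ = 1

namespace CMeasure

noncomputable def integral (ν : CMeasure) (g : ℂ → ℂ) : ℂ :=
  ∫ w, g w * ν.density w ∂ν.var

/-- The Cauchy transform `ν̂(z) = ∫ (w - z)⁻¹ dν(w)`. -/
noncomputable def cauchy (ν : CMeasure) (z : ℂ) : ℂ :=
  ∫ w, (w - z)⁻¹ * ν.density w ∂ν.var

/-- Total variation norm. -/
noncomputable def totalVar (ν : CMeasure) : ℝ := (ν.var Set.univ).toReal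

def SupportedIn (ν : CMeasure) (K : Set ℂ) : Prop := ν.var Kᶜ = 0

/-- The value of the complex measure on a set. -/
noncomputable def setFn (ν : CMeasure) (s : Set ℂ) : ℂ := ∫ w in s, ν.density w ∂ν.var

end CMeasure

/-- Arc-length measure on the circle of center `c` and radius `r`: the pushforward of
`r · dt` on `[0, 2π)` under `t ↦ c + r e^{it}`. -/
noncomputable def arcMeasure (c : ℂ) (r : ℝ) : Measure ℂ :=
  ENNReal.ofReal r • Measure.map (circleMap c r) (volume.restrict (Set.Ico 0 (2 * Real.pi)))

/-- `f` agrees on `K` with a rational function whose poles lie off `K`. -/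
def RationalOn (K : Set ℂ) (f : ℂ → ℂ) : Prop :=
  ∃ P Q : Polynomial ℂ, (∀ z ∈ K, Q.eval z ≠ 0) ∧ ∀ z ∈ K, f z = P.eval z / Q.eval z

/-- A C-compact: a compact set with empty interior on which every continuous function is
a uniform limit of rational functions with poles off the set. -/
def IsCCompact (K : Set ℂ) : Prop :=
  IsCompact K ∧ interior K = ∅ ∧
    ∀ f : ℂ → ℂ, ContinuousOn f K → ∀ ε > 0, ∃ g : ℂ → ℂ,
      RationalOn K g ∧ ∀ z ∈ K, ‖f z - g z‖ < ε

/-- An A-compact: a compact set on which every continuous function holomorphic on the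
interior is a uniform limit of rational functions with poles off the set. -/
def IsACompact (K : Set ℂ) : Prop :=
  IsCompact K ∧
    ∀ f : ℂ → ℂ, ContinuousOn f K → DifferentiableOn ℂ f (interior K) → ∀ ε > 0,
      ∃ g : ℂ → ℂ, RationalOn K g ∧ ∀ z ∈ K, ‖f z - g z‖ < ε

/-- A bounded circular domain: an open disk minus finitely many pairwise disjoint closed
subdisks. -/
structure CircularDomain where
  p : ℕ
  a₀ : ℂ
  R₀ : ℝ
  a : Fin p → ℂ
  R : Fin p → ℝ
  R₀_pos : 0 < R₀
  R_pos : ∀ j, 0 < R j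
  sub : ∀ j, Metric.closedBall (a j) (R j) ⊆ Metric.ball a₀ R₀
  disj : ∀ i j, i ≠ j → Disjoint (Metric.closedBall (a i) (R i)) (Metric.closedBall (a j) (R j))

namespace CircularDomain

def carrier (Δ : CircularDomain) : Set ℂ :=
  Metric.ball Δ.a₀ Δ.R₀ \ ⋃ j, Metric.closedBall (Δ.a j) (Δ.R j)

/-- The contour integral over `Γ_ε = {w ∈ Δ : dist(w, ∂Δ) = ε}`, oriented as the boundary
of the region between `Γ_ε` and `∂Δ` is traversed for Cauchy-type integrals: the circle
concentric with the outer boundary positively, the circles around the holes negatively. -/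
noncomputable def contourIntegral (Δ : CircularDomain) (ε : ℝ) (g : ℂ → ℂ) : ℂ :=
  (∮ z in C(Δ.a₀, Δ.R₀ - ε), g z) - ∑ j, (∮ z in C(Δ.a j, Δ.R j + ε), g z)

/-- `∫_{Γ_ε} |g(w)| |dw|`. -/
noncomputable def absIntegral (Δ : CircularDomain) (ε : ℝ) (g : ℂ → ℂ) : ℝ :=
  (∫ t in (0:ℝ)..(2 * Real.pi), ‖g (circleMap Δ.a₀ (Δ.R₀ - ε) t)‖ * (Δ.R₀ - ε)) +
    ∑ j, ∫ t in (0:ℝ)..(2 * Real.pi), ‖g (circleMap (Δ.a j) (Δ.R j + ε) t)‖ * (Δ.R j + ε)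

/-- Arc-length measure on the boundary `∂Δ`. -/
noncomputable def boundaryMeasure (Δ : CircularDomain) : Measure ℂ :=
  arcMeasure Δ.a₀ Δ.R₀ + ∑ j, arcMeasure (Δ.a j) (Δ.R j)

/-- The contour integral over `∂Δ` (outer circle positively oriented, inner circles
negatively oriented) of a (possibly only a.e. defined) function. -/
noncomputable def bdryIntegral (Δ : CircularDomain) (F : ℂ → ℂ) : ℂ :=
  (∮ z in C(Δ.a₀, Δ.R₀), F z) - ∑ j, (∮ z in C(Δ.a j, Δ.R j), F z)

end CircularDomain

/-- The `H¹`-type norm `limsup_{ε → 0⁺} ∫_{Γ_ε} |g(w)| |dw|`, valued in `ℝ≥0∞`. -/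
noncomputable def Hnorm (Δ : CircularDomain) (g : ℂ → ℂ) : ℝ≥0∞ :=
  Filter.limsup (fun ε : ℝ => ENNReal.ofReal (Δ.absIntegral ε g))
    (nhdsWithin 0 (Set.Ioi 0))

/-- `ψ` has radial limit `L` at the boundary point `w` of the circular domain `Δ`:
the limit along the radius of the corresponding boundary circle, from within `Δ`. -/
def HasRadialLimit (Δ : CircularDomain) (ψ : ℂ → ℂ) (w L : ℂ) : Prop :=
  (dist w Δ.a₀ = Δ.R₀ ∧
    Tendsto (fun r : ℝ => ψ (Δ.a₀ + (r : ℂ) * (w - Δ.a₀))) (nhdsWithin 1 (Set.Iio 1)) (nhds L)) ∨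
  (∃ j, dist w (Δ.a j) = Δ.R j ∧
    Tendsto (fun r : ℝ => ψ (Δ.a j + (r : ℂ) * (w - Δ.a j))) (nhdsWithin 1 (Set.Ioi 1)) (nhds L))

/-- `μ` is (a representative of) the harmonic measure of `Ω = ψ(Δ)`: the pushforward
under the a.e. defined radial boundary limit map of arc-length measure on `∂Δ`. -/
def IsHarmonicMeasure (Δ : CircularDomain) (ψ : ℂ → ℂ) (μ : Measure ℂ) : Prop :=
  ∃ ψs : ℂ → ℂ, Measurable ψs ∧
    (∀ᵐ w ∂Δ.boundaryMeasure, HasRadialLimit Δ ψ w (ψs w)) ∧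
    μ = Measure.map ψs Δ.boundaryMeasure

/-- A D-collection: radial limits of each uniformization exist on a full-measure subset of
the boundary on which the boundary map is one-to-one, and harmonic measures of different
domains are mutually singular. -/
def IsDCollection {ι : Type*} (Δ : ι → CircularDomain) (ψ : ι → ℂ → ℂ) : Prop :=
  (∀ i, ∃ (X : Set ℂ) (ψs : ℂ → ℂ), MeasurableSet X ∧ X ⊆ frontier (Δ i).carrier ∧
      (Δ i).boundaryMeasure Xᶜ = 0 ∧ (∀ w ∈ X, HasRadialLimit (Δ i) (ψ i) w (ψs w)) ∧
      Set.InjOn ψs X) ∧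
  Pairwise fun i j => ∃ μi μj : Measure ℂ, IsHarmonicMeasure (Δ i) (ψ i) μi ∧
    IsHarmonicMeasure (Δ j) (ψ j) μj ∧ μi ⟂ₘ μj

/-- The distance from a point `w` of the closed unit disc to the exterior point `(1 + s) z`
dominates both `‖w - z‖` and `s`. -/
theorem sq_add_sq_le_sq_norm_sub_one_add_mul {w z : ℂ} (hw : ‖w‖ ≤ 1) (hz : ‖z‖ = 1) {s : ℝ}
    (hs : 0 ≤ s) : ‖w - z‖ ^ 2 + s ^ 2 ≤ ‖w - (1 + s) * z‖ ^ 2 := by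
  have hw' : ‖w‖ ^ 2 ≤ 1 := pow_le_one₀ (norm_nonneg w) hw
  have hz' : ‖z‖ ^ 2 = 1 := by rw [hz, one_pow]
  simp only [Complex.sq_norm, Complex.normSq_apply] at *
  simp only [Complex.sub_re, Complex.sub_im, Complex.mul_re, Complex.mul_im, Complex.add_re,
    Complex.add_im, Complex.one_re, Complex.one_im, Complex.ofReal_re, Complex.ofReal_im]
  have h1 := mul_nonneg hs (add_nonneg (add_nonneg (sq_nonneg (w.re - z.re))
    (sq_nonneg (w.im - z.im))) (sub_nonneg.2 hw'))
  linear_combination h1 - (s + s ^ 2) * hz'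

theorem norm_prod_sub_one_le {ι : Type*} (t : Finset ι) (a : ι → ℂ) (ha : ∀ i ∈ t, ‖a i‖ ≤ 1) :
    ‖∏ i ∈ t, a i - 1‖ ≤ ∑ i ∈ t, ‖a i - 1‖ := by
  classical
  induction t using Finset.induction_on with
  | empty => simp
  | insert i t hi ih =>
    rw [Finset.prod_insert hi, Finset.sum_insert hi]
    have h := ih fun j hj => ha j (Finset.mem_insert_of_mem hj)
    calc ‖a i * ∏ j ∈ t, a j - 1‖ = ‖a i * (∏ j ∈ t, a j - 1) + (a i - 1)‖ := by ring_nf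
      _ ≤ ‖a i‖ * ‖∏ j ∈ t, a j - 1‖ + ‖a i - 1‖ := by
        rw [← norm_mul]; exact norm_add_le _ _
      _ ≤ ‖a i - 1‖ + ∑ j ∈ t, ‖a j - 1‖ := by
        nlinarith [ha i (Finset.mem_insert_self i t), norm_nonneg (∏ j ∈ t, a j - 1)]

/-- A compact subset of a metric space whose one-dimensional Hausdorff measure vanishes has finite
covers by balls centred on it with arbitrarily small total radius. -/
theorem IsCompact.exists_finset_cover_sum_lt {X : Type*} [MetricSpace X] [MeasurableSpace X]
    [BorelSpace X] {K : Set X} (hK : IsCompact K) (h0 : μH[1] K = 0) (hne : K.Nonempty)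
    {ε : ℝ} (hε : 0 < ε) :
    ∃ (t : Finset ℕ) (z : ℕ → X) (r : ℕ → ℝ), (∀ n, z n ∈ K) ∧ (∀ n, 0 < r n) ∧
      K ⊆ ⋃ n ∈ t, Metric.ball (z n) (r n) ∧ ∑ n ∈ t, r n < ε := by
  obtain ⟨x₀, hx₀⟩ := hne
  have hε2 : (0 : ℝ≥0∞) < ENNReal.ofReal (ε / 2) := ENNReal.ofReal_pos.2 (half_pos hε)
  rw [Measure.hausdorffMeasure_apply, ENNReal.iSup_eq_zero] at h0
  have h1 := ENNReal.iSup_eq_zero.1 (h0 1) one_pos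
  rw [← h1] at hε2
  simp only [iInf_lt_iff] at hε2
  obtain ⟨S, hKS, hS, hsum⟩ := hε2
  have hd : ∀ n, (⨆ _ : (S n).Nonempty, ediam (S n) ^ (1 : ℝ)) = ediam (S n) := by
    intro n
    rcases (S n).eq_empty_or_nonempty with h | h
    · simp [h]
    · simp [h]
  simp only [hd] at hsum
  obtain ⟨δ, hδ, hδsum⟩ := ENNReal.exists_pos_sum_of_countable
    (ENNReal.ofReal_pos.2 (half_pos hε)).ne' ℕ
  have hz : ∀ n, ∃ z ∈ K, (S n ∩ K).Nonempty → z ∈ S n := by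
    intro n
    by_cases h : (S n ∩ K).Nonempty
    · obtain ⟨z, hz⟩ := h
      exact ⟨z, hz.2, fun _ => hz.1⟩
    · exact ⟨x₀, hx₀, fun h' => absurd h' h⟩
  choose z hzK hzS using hz
  have hfin : ∀ n, ediam (S n) ≠ ∞ := fun n => ((hS n).trans_lt ENNReal.one_lt_top).ne
  have hsub : K ⊆ ⋃ n, Metric.ball (z n) ((ediam (S n)).toReal + δ n) := by
    intro x hx
    obtain ⟨n, hn⟩ := mem_iUnion.1 (hKS hx)
    refine mem_iUnion.2 ⟨n, ?_⟩
    rw [Metric.mem_ball]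
    have h2 : dist x (z n) ≤ (ediam (S n)).toReal :=
      Metric.dist_le_diam_of_mem' (hfin n) hn (hzS n ⟨x, hn, hx⟩)
    have h3 : (0 : ℝ) < δ n := hδ n
    linarith
  obtain ⟨t, ht⟩ := hK.elim_finite_subcover _ (fun n => Metric.isOpen_ball) hsub
  refine ⟨t, z, _, hzK, fun n => add_pos_of_nonneg_of_pos ENNReal.toReal_nonneg (hδ n), ht, ?_⟩
  rw [Finset.sum_add_distrib]
  have e1 : ∑ n ∈ t, (ediam (S n)).toReal < ε / 2 := by
    rw [← ENNReal.toReal_sum fun n _ => hfin n]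
    exact ENNReal.toReal_lt_of_lt_ofReal ((ENNReal.sum_le_tsum t).trans_lt hsum)
  have e2 : ∑ n ∈ t, (δ n : ℝ) < ε / 2 := by
    have : ∑ n ∈ t, (δ n : ℝ) = (∑ n ∈ t, (δ n : ℝ≥0∞)).toReal := by
      rw [ENNReal.toReal_sum fun n _ => ENNReal.coe_ne_top]; simp
    rw [this]
    exact ENNReal.toReal_lt_of_lt_ofReal ((ENNReal.sum_le_tsum t).trans_lt hδsum)
  exact (add_lt_add e1 e2).trans_eq (add_halves ε)

/-- A compact subset `K` of the unit circle of linear measure zero is, up to any `ε`, the zero set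
of a function that is holomorphic past the closed unit disc, bounded by `1` on the circle, and
close to `1` away from `K`. -/
theorem exists_differentiableOn_small_on_null {K : Set ℂ} (hK : IsCompact K)
    (hKs : K ⊆ Metric.sphere 0 1) (h0 : μH[1] K = 0) (hne : K.Nonempty) {ε : ℝ} (hε : 0 < ε) :
    ∃ (g : ℂ → ℂ) (R : ℝ), 1 < R ∧ DifferentiableOn ℂ g (Metric.ball 0 R) ∧ Measurable g ∧
      (∀ w ∈ Metric.sphere (0 : ℂ) 1, ‖g w‖ ≤ 1) ∧ (∀ w ∈ K, ‖g w‖ ≤ ε) ∧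
      ∀ w ∈ Metric.sphere (0 : ℂ) 1, w ∉ K → ‖g w - 1‖ ≤ ε / infDist w K := by
  obtain ⟨t, z, r, hz, hr, hcov, hsum⟩ := hK.exists_finset_cover_sum_lt h0 hne (pow_pos hε 2)
  have hz1 : ∀ n, ‖z n‖ = 1 := fun n => mem_sphere_zero_iff_norm.1 (hKs (hz n))
  set s : ℕ → ℝ := fun n => r n / ε
  have hspos : ∀ n, 0 < s n := fun n => div_pos (hr n) hε
  have key : ∀ n, ∀ w ∈ Metric.sphere (0 : ℂ) 1,
      ‖w - z n‖ ^ 2 + s n ^ 2 ≤ ‖w - (1 + s n) * z n‖ ^ 2 := fun n w hw =>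
    sq_add_sq_le_sq_norm_sub_one_add_mul (mem_sphere_zero_iff_norm.1 hw).le (hz1 n) (hspos n).le
  have kz : ∀ n, ∀ w ∈ Metric.sphere (0 : ℂ) 1, ‖w - z n‖ ≤ ‖w - (1 + s n) * z n‖ :=
    fun n w hw => le_of_sq_le_sq (by nlinarith [key n w hw]) (norm_nonneg _)
  have ks : ∀ n, ∀ w ∈ Metric.sphere (0 : ℂ) 1, s n ≤ ‖w - (1 + s n) * z n‖ :=
    fun n w hw => le_of_sq_le_sq (by nlinarith [key n w hw, norm_nonneg (w - z n)]) (norm_nonneg _)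
  have kle : ∀ n, ∀ w ∈ Metric.sphere (0 : ℂ) 1, ‖(w - z n) / (w - (1 + s n) * z n)‖ ≤ 1 := by
    intro n w hw
    rw [norm_div]
    exact div_le_one_of_le₀ (kz n w hw) (norm_nonneg _)
  obtain ⟨R, hR, hRs⟩ : ∃ R : ℝ, 1 < R ∧ ∀ n ∈ t, R < 1 + s n := by
    have h1 : ∀ᶠ R in 𝓝[>] (1 : ℝ), ∀ n ∈ t, R < 1 + s n :=
      (Filter.eventually_all_finset t).2 fun n _ =>
        nhdsWithin_le_nhds (eventually_lt_nhds (by linarith [hspos n]))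
    obtain ⟨R, hR, hR1⟩ := (h1.and self_mem_nhdsWithin).exists
    exact ⟨R, hR1, hR⟩
  refine ⟨fun w => ∏ n ∈ t, (w - z n) / (w - (1 + s n) * z n), R, hR, ?_, ?_, ?_, ?_, ?_⟩
  · refine DifferentiableOn.fun_finsetProd fun n hn => ?_
    refine DifferentiableOn.div (by fun_prop) (by fun_prop) fun w hw h => ?_
    rw [sub_eq_zero] at h
    have h2 : ‖w‖ < R := mem_ball_zero_iff.1 hw
    have h3 : ‖w‖ = 1 + s n := by
      rw [h, norm_mul, hz1, mul_one, ← Complex.ofReal_one, ← Complex.ofReal_add,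
        Complex.norm_of_nonneg (by linarith [hspos n])]
    linarith [hRs n hn]
  · fun_prop
  · intro w hw
    rw [norm_prod]
    exact Finset.prod_le_one (fun _ _ => norm_nonneg _) fun n _ => kle n w hw
  · intro w hw
    obtain ⟨n, hn, hwn⟩ := mem_iUnion₂.1 (hcov hw)
    rw [norm_prod, ← Finset.mul_prod_erase t _ hn]
    have h1 : ‖(w - z n) / (w - (1 + s n) * z n)‖ ≤ ε := by
      rw [norm_div, div_le_iff₀ ((hspos n).trans_le (ks n w (hKs hw)))]
      have h2 : ‖w - z n‖ < r n := by rwa [← dist_eq_norm]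
      have h3 : ε * s n = r n := mul_div_cancel₀ _ hε.ne'
      nlinarith [ks n w (hKs hw)]
    have h4 : ∏ m ∈ t.erase n, ‖(w - z m) / (w - (1 + s m) * z m)‖ ≤ 1 :=
      Finset.prod_le_one (fun _ _ => norm_nonneg _) fun m _ => kle m w (hKs hw)
    exact (mul_le_of_le_one_right (norm_nonneg _) h4).trans h1
  · intro w hw hwK
    have hd : 0 < infDist w K := (hK.isClosed.notMem_iff_infDist_pos hne).1 hwK
    refine (norm_prod_sub_one_le t _ fun n _ => kle n w hw).trans ?_
    have h1 : ∀ n ∈ t, ‖(w - z n) / (w - (1 + s n) * z n) - 1‖ ≤ s n / infDist w K := by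
      intro n _
      have hpos := (hspos n).trans_le (ks n w hw)
      have h2 : (w - z n) / (w - (1 + s n) * z n) - 1 = s n * z n / (w - (1 + s n) * z n) := by
        rw [div_sub_one (norm_pos_iff.1 hpos)]; ring
      rw [h2, norm_div, norm_mul, hz1, mul_one, Complex.norm_of_nonneg (hspos n).le]
      refine div_le_div_of_nonneg_left (hspos n).le hd ?_
      refine (infDist_le_dist_of_mem (hz n)).trans ?_
      rw [dist_eq_norm]
      exact kz n w hw
    refine (Finset.sum_le_sum h1).trans ?_
    rw [← Finset.sum_div]
    refine div_le_div_of_nonneg_right ?_ hd.le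
    rw [← Finset.sum_div, div_le_iff₀ hε]
    nlinarith

/-- A compact subset of the unit circle that is null for arc length has vanishing one-dimensional
Hausdorff measure. -/
theorem hausdorffMeasure_eq_zero_of_arcMeasure {K : Set ℂ} (hK : IsCompact K)
    (hKs : K ⊆ Metric.sphere 0 1) (h0 : arcMeasure 0 1 K = 0) : μH[1] K = 0 := by
  have hm : Measurable (circleMap 0 1) := (continuous_circleMap 0 1).measurable
  simp only [arcMeasure, ENNReal.ofReal_one, one_smul] at h0
  rw [Measure.map_apply hm hK.measurableSet, restrict_Ico_eq_restrict_Ioc,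
    Measure.restrict_apply (hm hK.measurableSet), ← hausdorffMeasure_real] at h0
  have hsub : K ⊆ circleMap 0 1 '' (circleMap 0 1 ⁻¹' K ∩ Ioc 0 (2 * Real.pi)) := by
    intro w hw
    have h1 := hKs hw
    rw [← abs_one, ← image_circleMap_Ioc] at h1
    obtain ⟨θ, hθ, rfl⟩ := h1
    exact ⟨θ, ⟨hw, hθ⟩, rfl⟩
  refine measure_mono_null hsub (le_antisymm ?_ bot_le)
  refine ((lipschitzWith_circleMap 0 1).hausdorffMeasure_image_le zero_le_one _).trans ?_
  rw [h0, mul_zero]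

namespace CMeasure

variable (ν : CMeasure)

theorem ae_mem_of_supportedIn {K : Set ℂ} (h : ν.SupportedIn K) : ∀ᵐ w ∂ν.var, w ∈ K := h

/-- A complex measure on the unit circle whose positive moments vanish annihilates `w * g w` for
every `g` holomorphic in a neighbourhood of the closed unit disc. -/
theorem integral_mul_eq_zero_of_differentiableOn
    (hsupp : ν.SupportedIn (Metric.sphere (0 : ℂ) 1))
    (hmom : ∀ n : ℕ, 1 ≤ n → ν.integral (fun w => w ^ n) = 0) {g : ℂ → ℂ} {R : ℝ} (hR : 1 < R)
    (hg : DifferentiableOn ℂ g (Metric.ball 0 R)) :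
    ν.integral (fun w => w * g w) = 0 := by
  have := ν.finite
  set c : ℕ → ℂ := fun n => (n.factorial : ℂ)⁻¹ * iteratedDeriv n g 0 with hc
  have hT : ∀ w ∈ Metric.ball (0 : ℂ) R, HasSum (fun n => c n * w ^ n) (g w) := by
    intro w hw
    refine (hasSum_taylorSeries_on_ball hg hw).congr_fun fun n => ?_
    simp [hc]; ring
  have hcs : Summable fun n => ‖c n‖ := by
    simpa using (hT 1 (by simpa using hR)).summable.norm
  have hsph := ν.ae_mem_of_supportedIn hsupp
  have hnorm : ∀ n, ∀ᵐ w ∂ν.var, ‖c n * (w ^ (n + 1) * ν.density w)‖ = ‖c n‖ := by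
    intro n
    filter_upwards [hsph, ν.norm_density] with w hw hd
    simp [hd, mem_sphere_zero_iff_norm.1 hw]
  have hint : ∀ n, Integrable (fun w => c n * (w ^ (n + 1) * ν.density w)) ν.var := by
    intro n
    refine Integrable.of_bound (C := ‖c n‖) ?_ ((hnorm n).mono fun w hw => hw.le)
    have := ν.meas_density
    exact Measurable.aestronglyMeasurable (by fun_prop)
  have hsum := hasSum_integral_of_summable_integral_norm hint (by
    simp_rw [fun n => integral_congr_ae (hnorm n), integral_const, smul_eq_mul]
    exact hcs.mul_left _)
  have hzero : ∀ n, ∫ w, c n * (w ^ (n + 1) * ν.density w) ∂ν.var = 0 := by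
    intro n
    rw [integral_const_mul]
    exact mul_eq_zero_of_right _ (hmom (n + 1) (Nat.le_add_left 1 n))
  simp only [hzero] at hsum
  rw [CMeasure.integral, ← hsum.unique hasSum_zero]
  refine integral_congr_ae ?_
  filter_upwards [hsph] with w hw
  have hwR : w ∈ Metric.ball (0 : ℂ) R := by
    rw [mem_ball_zero_iff, mem_sphere_zero_iff_norm.1 hw]; exact hR
  have h1 := (hT w hwR).mul_left (w * ν.density w)
  rw [mul_right_comm, ← h1.tsum_eq]
  exact tsum_congr fun n => by ring

/-- A complex measure on the unit circle whose positive moments vanish has vanishing first moment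
on every compact subset of the circle of linear measure zero. -/
theorem setIntegral_mul_density_eq_zero (hsupp : ν.SupportedIn (Metric.sphere (0 : ℂ) 1))
    (hmom : ∀ n : ℕ, 1 ≤ n → ν.integral (fun w => w ^ n) = 0) {K : Set ℂ} (hK : IsCompact K)
    (hKs : K ⊆ Metric.sphere 0 1) (h0 : μH[1] K = 0) :
    ∫ w in K, w * ν.density w ∂ν.var = 0 := by
  have := ν.finite
  have hd := ν.meas_density
  rcases K.eq_empty_or_nonempty with rfl | hne
  · simp
  have hsph := ν.ae_mem_of_supportedIn hsupp
  have hε : ∀ n : ℕ, (0 : ℝ) < 1 / ((n : ℝ) + 1) := fun n => Nat.one_div_pos_of_nat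
  choose g R hR hg hgm hg1 hgK hgK' using
    fun n : ℕ => exists_differentiableOn_small_on_null hK hKs h0 hne (hε n)
  have hlim0 : Tendsto (fun n : ℕ => 1 / ((n : ℝ) + 1)) atTop (𝓝 0) :=
    tendsto_one_div_add_atTop_nhds_zero_nat
  have hlim : Tendsto (fun n => ∫ w, w * g n w * ν.density w ∂ν.var) atTop
      (𝓝 (∫ w, Kᶜ.indicator (fun w => w * ν.density w) w ∂ν.var)) := by
    refine tendsto_integral_filter_of_norm_le_const (.of_forall fun n => ?_)
      ⟨1, .of_forall fun n => ?_⟩ ?_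
    · have := hgm n
      exact Measurable.aestronglyMeasurable (by fun_prop)
    · filter_upwards [hsph, ν.norm_density] with w hw hdw
      simpa [hdw, mem_sphere_zero_iff_norm.1 hw] using hg1 n w hw
    · filter_upwards [hsph] with w hw
      by_cases hwK : w ∈ K
      · have h1 : Tendsto (fun n => g n w) atTop (𝓝 0) :=
          squeeze_zero_norm (fun n => hgK n w hwK) hlim0
        simpa [hwK] using (h1.const_mul w).mul_const (ν.density w)
      · have h1 : Tendsto (fun n => g n w) atTop (𝓝 1) := by
          refine tendsto_iff_norm_sub_tendsto_zero.2 ?_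
          refine squeeze_zero (fun n => norm_nonneg _) (fun n => hgK' n w hw hwK) ?_
          simpa using hlim0.div_const (infDist w K)
        simpa [hwK] using (h1.const_mul w).mul_const (ν.density w)
  have hzero : ∀ n, ∫ w, w * g n w * ν.density w ∂ν.var = 0 := fun n =>
    ν.integral_mul_eq_zero_of_differentiableOn hsupp hmom (hR n) (hg n)
  simp only [hzero, tendsto_const_nhds_iff] at hlim
  rw [integral_indicator hK.measurableSet.compl] at hlim
  have hint : Integrable (fun w => w * ν.density w) ν.var := by
    refine Integrable.of_bound (C := 1) (Measurable.aestronglyMeasurable (by fun_prop)) ?_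
    filter_upwards [hsph, ν.norm_density] with w hw hdw
    simp [hdw, mem_sphere_zero_iff_norm.1 hw]
  have htot : ∫ w, w * ν.density w ∂ν.var = 0 := by
    simpa [CMeasure.integral] using hmom 1 le_rfl
  simpa [← hlim, htot] using integral_add_compl hK.measurableSet hint

/-- If the first moment of `ν` vanishes on all compact subsets of a compact subset `K` of the unit
circle, then `K` is `ν`-null. -/
theorem var_eq_zero_of_forall_setIntegral_eq_zero {K : Set ℂ} (hK : IsCompact K)
    (hKs : K ⊆ Metric.sphere 0 1)
    (h : ∀ L ⊆ K, IsCompact L → ∫ w in L, w * ν.density w ∂ν.var = 0) : ν.var K = 0 := by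
  have := ν.finite
  have hd := ν.meas_density
  have hnorm : ∀ᵐ w ∂ν.var.restrict K, ‖w * ν.density w‖ = 1 := by
    filter_upwards [ae_restrict_mem hK.measurableSet, ae_restrict_of_ae ν.norm_density]
      with w hw hdw
    simp [hdw, mem_sphere_zero_iff_norm.1 (hKs hw)]
  have hint : Integrable (fun w => w * ν.density w) (ν.var.restrict K) :=
    Integrable.of_bound (C := 1) (Measurable.aestronglyMeasurable (by fun_prop))
      (hnorm.mono fun w hw => hw.le)
  have hae := ae_eq_zero_of_forall_setIntegral_isClosed_eq_zero hint fun s hs => by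
    rw [Measure.restrict_restrict hs.measurableSet]
    exact h _ inter_subset_right (hK.inter_left hs)
  have hfalse : ∀ᵐ w ∂ν.var.restrict K, False := by
    filter_upwards [hnorm, hae] with w h1 h2
    simp [h2] at h1
  rwa [eventually_false_iff_eq_bot, ae_eq_bot, Measure.restrict_eq_zero] at hfalse

end CMeasure

/-- **F. and M. Riesz Theorem.** If all positive moments of a finite complex measure on
the unit circle vanish, then the measure is absolutely continuous with respect to
arc-length measure on the circle. -/
theorem fm_riesz (ν : CMeasure) (hsupp : ν.SupportedIn (Metric.sphere (0 : ℂ) 1))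
    (hmom : ∀ n : ℕ, 1 ≤ n → ν.integral (fun w => w ^ n) = 0) :
    ν.var ≪ arcMeasure 0 1 := by
  have := ν.finite
  refine Measure.AbsolutelyContinuous.mk fun E hE hE0 => ?_
  rw [← measure_inter_add_sdiff E (t := Metric.sphere 0 1) isClosed_sphere.measurableSet,
    measure_mono_null (s := E \ Metric.sphere 0 1) (fun w hw => hw.2) hsupp, add_zero]
  by_contra hpos
  obtain ⟨K, hKE, hK, hKpos⟩ := (hE.inter isClosed_sphere.measurableSet).exists_lt_isCompact
    (pos_iff_ne_zero.2 hpos)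
  refine hKpos.ne' (ν.var_eq_zero_of_forall_setIntegral_eq_zero hK (fun w hw => (hKE hw).2)
    fun L hLK hL => ?_)
  have hLs : L ⊆ Metric.sphere 0 1 := fun w hw => (hKE (hLK hw)).2
  exact ν.setIntegral_mul_density_eq_zero hsupp hmom hL hLs
    (hausdorffMeasure_eq_zero_of_arcMeasure hL hLs
      (measure_mono_null (fun w hw => (hKE (hLK hw)).1) hE0))
end

section
/- Let K be a compact subset of the closed unit disk such that the arc-length measure of K ∩ S¹ is zero, and let ν_K be a finite complex Borel measure supported on K such that the function t ↦ ν̂_K(e^{it}) is defined for almost every t ∈ [0,2π) and belongs to L¹(0,2π). Let ν_c be the measure on S¹ defined by dν_c(e^{it}) = (1/2π) e^{it} ν̂_K(e^{it}) dt, and set ν = ν_K + ν_c. Then ν̂(z) = ν̂_K(z) for every z in the open unit disk with z ∉ K, and ν̂(z) = 0 for every z with |z| > 1. -/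
open MeasureTheory Filter Set Metric Complex Topology
open scoped ENNReal NNReal

/-- The transform `u ↦ ∫ b(w) (1 - u w)⁻¹ dμ(w)`, which is `-u⁻¹` times the Cauchy transform of
`b · μ` at `u⁻¹`. -/
noncomputable def invCauchy (μ : Measure ℂ) (b : ℂ → ℂ) (u : ℂ) : ℂ :=
  ∫ w, b w * (1 - u * w)⁻¹ ∂μ

/-- Mean value property over circles around the origin, parametrized clockwise. -/
lemma integral_circleMap_neg_eq {F : ℂ → ℂ} {r : ℝ} (hr : 0 ≤ r)
    (hF : DifferentiableOn ℂ F (closedBall 0 r)) :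
    ∫ t in (0:ℝ)..(2 * Real.pi), F (circleMap 0 r (-t)) = 2 * Real.pi * F 0 := by
  have hmean : Real.circleAverage F 0 r = F 0 := by
    refine circleAverage_of_differentiable_on_off_countable countable_empty
      (by rw [abs_of_nonneg hr]; exact hF.continuousOn) fun z hz => ?_
    rw [abs_of_nonneg hr, Set.sdiff_empty] at hz
    exact hF.differentiableAt (mem_of_superset (isOpen_ball.mem_nhds hz) ball_subset_closedBall)
  have hper : Function.Periodic (fun t : ℝ => F (circleMap 0 r t)) (2 * Real.pi) :=
    fun t => by simp only [periodic_circleMap 0 r t]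
  have hshift := hper.intervalIntegral_add_eq (-(2 * Real.pi)) 0
  rw [neg_add_cancel, zero_add] at hshift
  rw [intervalIntegral.integral_comp_neg (fun t : ℝ => F (circleMap 0 r t)), neg_zero, hshift,
    ← hmean, Real.circleAverage_def, Complex.real_smul]
  push_cast
  field_simp

/-- Mean value property over the unit circle of a bounded holomorphic function with
radial limits. -/
lemma integral_radialLimit_of_bounded {F : ℂ → ℂ} {φ : ℝ → ℂ} {C : ℝ}
    (hF : DifferentiableOn ℂ F (ball 0 1)) (hC : ∀ u ∈ ball (0 : ℂ) 1, ‖F u‖ ≤ C)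
    (hlim : ∀ᵐ t : ℝ, t ∈ Set.uIoc 0 (2 * Real.pi) →
      Tendsto (fun r : ℝ => F (circleMap 0 r (-t))) (𝓝[<] 1) (𝓝 (φ t))) :
    ∫ t in (0:ℝ)..(2 * Real.pi), φ t = 2 * Real.pi * F 0 := by
  have hr : ∀ᶠ r : ℝ in 𝓝[<] 1, r ∈ Set.Ioo (0:ℝ) 1 := Ioo_mem_nhdsLT one_pos
  have hmem : ∀ r ∈ Set.Ioo (0:ℝ) 1, ∀ t, circleMap 0 r t ∈ ball (0 : ℂ) 1 := fun r hr t => by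
    simpa [abs_of_pos hr.1] using hr.2
  have htend : Tendsto (fun r : ℝ => ∫ t in (0:ℝ)..(2 * Real.pi), F (circleMap 0 r (-t)))
      (𝓝[<] 1) (𝓝 (∫ t in (0:ℝ)..(2 * Real.pi), φ t)) := by
    refine intervalIntegral.tendsto_integral_filter_of_dominated_convergence (fun _ => C)
      ?_ ?_ intervalIntegrable_const hlim
    · filter_upwards [hr] with r hr
      refine Continuous.aestronglyMeasurable ?_
      exact hF.continuousOn.comp_continuous ((continuous_circleMap 0 r).comp continuous_neg)
        fun t => hmem r hr (-t)
    · filter_upwards [hr] with r hr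
      exact Eventually.of_forall fun t _ => hC _ (hmem r hr (-t))
  refine tendsto_nhds_unique htend (tendsto_const_nhds.congr' ?_)
  filter_upwards [hr] with r hr
  exact (integral_circleMap_neg_eq hr.1.le (hF.mono (closedBall_subset_ball hr.2))).symm

lemma one_le_norm_one_add_smul {z : ℂ} (hz : 0 ≤ z.re) {ε : ℝ} (hε : 0 ≤ ε) :
    1 ≤ ‖1 + ε * z‖ := by
  refine le_trans ?_ (Complex.re_le_norm _)
  simp
  positivity

lemma mul_norm_one_add_le {z : ℂ} (hz : 0 ≤ z.re) {ε : ℝ} (hε : 0 ≤ ε) (hε1 : ε ≤ 1) :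
    ε * ‖1 + z‖ ≤ ‖1 + ε * z‖ := by
  refine (sq_le_sq₀ (by positivity) (norm_nonneg _)).1 ?_
  rw [mul_pow, ← Complex.normSq_eq_norm_sq, ← Complex.normSq_eq_norm_sq, Complex.normSq_apply,
    Complex.normSq_apply]
  simp
  nlinarith [mul_nonneg hε hz, mul_nonneg hε (sub_nonneg.2 hε1), mul_self_nonneg (ε - 1),
    mul_nonneg (mul_nonneg hε hz) (sub_nonneg.2 hε1)]

/-- Mean value property over the unit circle of a holomorphic function with integrable radial
limits, dominated by a product of holomorphic functions with nonnegative real part (a form of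
Smirnov's theorem). -/
lemma integral_radialLimit_of_le_prod {ι : Type*} [Fintype ι] {P : ι → ℂ → ℂ} {p : ι → ℝ → ℂ}
    {h : ℂ → ℂ} {φ : ℝ → ℂ} {C : ℝ}
    (hP : ∀ i, DifferentiableOn ℂ (P i) (ball 0 1))
    (hre : ∀ i, ∀ u ∈ ball (0 : ℂ) 1, 0 ≤ (P i u).re)
    (hp : ∀ i, Measurable (p i))
    (hPlim : ∀ i, ∀ᵐ t : ℝ, t ∈ Set.uIoc 0 (2 * Real.pi) →
      Tendsto (fun r : ℝ => P i (circleMap 0 r (-t))) (𝓝[<] 1) (𝓝 (p i t)))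
    (hh : DifferentiableOn ℂ h (ball 0 1))
    (hle : ∀ u ∈ ball (0 : ℂ) 1, ‖h u‖ ≤ C * ∏ i, ‖1 + P i u‖)
    (hlim : ∀ᵐ t : ℝ, t ∈ Set.uIoc 0 (2 * Real.pi) →
      Tendsto (fun r : ℝ => h (circleMap 0 r (-t))) (𝓝[<] 1) (𝓝 (φ t)))
    (hφ : IntervalIntegrable φ volume 0 (2 * Real.pi)) :
    ∫ t in (0:ℝ)..(2 * Real.pi), φ t = 2 * Real.pi * h 0 := by
  have hr : ∀ᶠ r : ℝ in 𝓝[<] 1, r ∈ Set.Ioo (0:ℝ) 1 := Ioo_mem_nhdsLT one_pos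
  have hmem : ∀ r ∈ Set.Ioo (0:ℝ) 1, ∀ t, circleMap 0 r t ∈ ball (0 : ℂ) 1 := fun r hr t => by
    simpa [abs_of_pos hr.1] using hr.2
  have hpre : ∀ᵐ t : ℝ, t ∈ Set.uIoc 0 (2 * Real.pi) → ∀ i, 0 ≤ (p i t).re := by
    filter_upwards [ae_all_iff.2 hPlim] with t ht htm i
    refine ge_of_tendsto ((Complex.continuous_re.tendsto _).comp (ht i htm)) ?_
    filter_upwards [hr] with r hr
    exact hre i _ (hmem r hr _)
  have hε : ∀ᶠ ε : ℝ in 𝓝[>] 0, ε ∈ Set.Ioo (0:ℝ) 1 := Ioo_mem_nhdsGT one_pos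
  have hC : 0 ≤ C := by
    have h0 := (norm_nonneg _).trans (hle 0 (mem_ball_self one_pos))
    refine nonneg_of_mul_nonneg_left h0 (Finset.prod_pos fun i _ => ?_)
    have := one_le_norm_one_add_smul (hre i 0 (mem_ball_self one_pos)) zero_le_one
    simp only [Complex.ofReal_one, one_mul] at this
    linarith
  have hreg : ∀ ε ∈ Set.Ioo (0:ℝ) 1,
      ∫ t in (0:ℝ)..(2 * Real.pi), φ t * ∏ i, (1 + (ε : ℂ) * p i t)⁻¹ =
        2 * Real.pi * (h 0 * ∏ i, (1 + (ε : ℂ) * P i 0)⁻¹) := by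
    intro ε hε
    have hne : ∀ z : ℂ, 0 ≤ z.re → 1 + (ε : ℂ) * z ≠ 0 := fun z hz =>
      norm_pos_iff.1 (one_pos.trans_le (one_le_norm_one_add_smul hz hε.1.le))
    refine integral_radialLimit_of_bounded
      (F := fun u => h u * ∏ i, (1 + (ε : ℂ) * P i u)⁻¹)
      (C := C * ∏ _i : ι, ε⁻¹) ?_ ?_ ?_
    · refine hh.mul (DifferentiableOn.fun_finsetProd fun i _ => ?_)
      exact (((hP i).const_mul _).const_add _).inv fun u hu => hne _ (hre i u hu)
    · intro u hu
      rw [norm_mul, norm_prod]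
      calc _ ≤ (C * ∏ i, ‖1 + P i u‖) * ∏ i, ‖(1 + (ε : ℂ) * P i u)⁻¹‖ := by
            gcongr; exact hle u hu
        _ = C * ∏ i, ‖1 + P i u‖ * ‖(1 + (ε : ℂ) * P i u)⁻¹‖ := by
            rw [Finset.prod_mul_distrib, mul_assoc]
        _ ≤ _ := by
            gcongr with i
            rw [norm_inv, ← div_eq_mul_inv,
              div_le_iff₀ (norm_pos_iff.2 (hne _ (hre i u hu))), inv_mul_eq_div,
              le_div_iff₀ hε.1, mul_comm]
            exact mul_norm_one_add_le (hre i u hu) hε.1.le hε.2.le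
    · filter_upwards [ae_all_iff.2 hPlim, hlim, hpre] with t ht ht' htp htm
      refine (ht' htm).mul (tendsto_finsetProd _ fun i _ => ?_)
      exact (((ht i htm).const_mul _).const_add _).inv₀ (hne _ (htp htm i))
  have htend : Tendsto (fun ε : ℝ => ∫ t in (0:ℝ)..(2 * Real.pi),
      φ t * ∏ i, (1 + (ε : ℂ) * p i t)⁻¹) (𝓝[>] 0)
      (𝓝 (∫ t in (0:ℝ)..(2 * Real.pi), φ t)) := by
    refine intervalIntegral.tendsto_integral_filter_of_dominated_convergence (fun t => ‖φ t‖)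
      ?_ ?_ hφ.norm ?_
    · refine Eventually.of_forall fun ε => ?_
      refine (intervalIntegrable_iff.1 hφ).aestronglyMeasurable.mul (Measurable.aestronglyMeasurable ?_)
      exact Finset.measurable_fun_prod _ fun i _ => (((hp i).const_mul _).const_add _).inv
    · filter_upwards [hε] with ε hε
      filter_upwards [hpre] with t htp htm
      rw [norm_mul, norm_prod]
      refine mul_le_of_le_one_right (norm_nonneg _)
        (Finset.prod_le_one (fun i _ => norm_nonneg _) fun i _ => ?_)
      rw [norm_inv]
      exact inv_le_one_of_one_le₀ (one_le_norm_one_add_smul (htp htm i) hε.1.le)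
    · refine Eventually.of_forall fun t _ => ?_
      have : ContinuousAt (fun ε : ℝ => φ t * ∏ i, (1 + (ε : ℂ) * p i t)⁻¹) 0 := by
        fun_prop (disch := simp)
      simpa using this.tendsto.mono_left nhdsWithin_le_nhds
  have htend0 : Tendsto (fun ε : ℝ => 2 * Real.pi * (h 0 * ∏ i, (1 + (ε : ℂ) * P i 0)⁻¹))
      (𝓝[>] 0) (𝓝 (2 * Real.pi * h 0)) := by
    have : ContinuousAt
        (fun ε : ℝ => 2 * Real.pi * (h 0 * ∏ i, (1 + (ε : ℂ) * P i 0)⁻¹)) 0 := by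
      fun_prop (disch := simp)
    simpa using this.tendsto.mono_left nhdsWithin_le_nhds
  refine tendsto_nhds_unique htend (htend0.congr' ?_)
  filter_upwards [hε] with ε hε
  exact (hreg ε hε).symm

section invCauchy

variable {μ : Measure ℂ} [IsFiniteMeasure μ] {b : ℂ → ℂ} {M : ℝ}

lemma integrable_of_measurable_of_bounded (hb : Measurable b) (hM : ∀ᵐ w ∂μ, ‖b w‖ ≤ M) :
    Integrable b μ :=
  Integrable.of_bound hb.aestronglyMeasurable M hM

lemma integrable_mul_inv_of_le {δ : ℝ} (hδ : 0 < δ) (hb : Measurable b)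
    (hM : ∀ᵐ w ∂μ, ‖b w‖ ≤ M) {g : ℂ → ℂ} (hg : Measurable g)
    (hd : ∀ᵐ w ∂μ, δ ≤ ‖g w‖) : Integrable (fun w => b w * (g w)⁻¹) μ := by
  refine integrable_of_measurable_of_bounded (M := M * δ⁻¹) (by fun_prop) ?_
  filter_upwards [hM, hd] with w hM hd
  rw [norm_mul, norm_inv]
  gcongr
  exact (norm_nonneg _).trans hM

lemma le_norm_one_sub_mul {u w : ℂ} {s : ℝ} (hu : ‖u‖ ≤ s) (hw : ‖w‖ ≤ 1) :
    1 - s ≤ ‖1 - u * w‖ := by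
  have h1 : ‖u * w‖ ≤ s := by
    rw [norm_mul]
    exact (mul_le_of_le_one_right (norm_nonneg _) hw).trans hu
  have h2 := norm_sub_norm_le (1 : ℂ) (u * w)
  rw [norm_one] at h2
  linarith

lemma invCauchy_differentiableOn (hw : ∀ᵐ w ∂μ, ‖w‖ ≤ 1) (hb : Measurable b)
    (hM : ∀ᵐ w ∂μ, ‖b w‖ ≤ M) : DifferentiableOn ℂ (invCauchy μ b) (ball 0 1) := by
  intro u hu
  obtain ⟨s, hus, hs1⟩ := exists_between (mem_ball_zero_iff.1 hu)
  have hs : 0 < 1 - s := by linarith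
  refine DifferentiableAt.differentiableWithinAt (HasDerivAt.differentiableAt
    (hasDerivAt_integral_of_dominated_loc_of_deriv_le (μ := μ) (s := ball 0 s)
      (F := fun u w => b w * (1 - u * w)⁻¹)
      (F' := fun u w => b w * (w / (1 - u * w) ^ 2)) (bound := fun _ => M * (1 / (1 - s) ^ 2))
      (isOpen_ball.mem_nhds (mem_ball_zero_iff.2 hus)) ?_ ?_ ?_ ?_ ?_ ?_).2)
  · exact Eventually.of_forall fun v => Measurable.aestronglyMeasurable (by fun_prop)
  · refine integrable_mul_inv_of_le hs hb hM (by fun_prop) ?_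
    filter_upwards [hw] with w hw using le_norm_one_sub_mul hus.le hw
  · exact Measurable.aestronglyMeasurable (by fun_prop)
  · filter_upwards [hw, hM] with w hw hM v hv
    have := le_norm_one_sub_mul (mem_ball_zero_iff.1 hv).le hw
    rw [norm_mul, norm_div, norm_pow]
    gcongr
    exact (norm_nonneg _).trans hM
  · exact integrable_const _
  · filter_upwards [hw] with w hw v hv
    have hne : 1 - v * w ≠ 0 :=
      norm_pos_iff.1 (hs.trans_le (le_norm_one_sub_mul (mem_ball_zero_iff.1 hv).le hw))
    have h1 : HasDerivAt (fun v : ℂ => 1 - v * w) (-w) v := by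
      simpa using ((hasDerivAt_id v).mul_const w).const_sub 1
    simpa using (h1.inv hne).const_mul (b w)

lemma tendsto_invCauchy_radial (hw : ∀ᵐ w ∂μ, ‖w‖ ≤ 1) (hb : Measurable b)
    (hM : ∀ᵐ w ∂μ, ‖b w‖ ≤ M) {η : ℂ} (hη : ‖η‖ = 1) {δ : ℝ} (hδ : 0 < δ)
    (hd : ∀ᵐ w ∂μ, δ ≤ ‖1 - η * w‖) :
    Tendsto (fun r : ℝ => invCauchy μ b (r * η)) (𝓝[<] 1) (𝓝 (invCauchy μ b η)) := by
  have hr : ∀ᶠ r : ℝ in 𝓝[<] 1, r ∈ Set.Ioo (0:ℝ) 1 := Ioo_mem_nhdsLT one_pos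
  refine tendsto_integral_filter_of_dominated_convergence (fun _ => M * (δ / 2)⁻¹) ?_ ?_
    (integrable_const _) ?_
  · exact Eventually.of_forall fun r => Measurable.aestronglyMeasurable (by fun_prop)
  · filter_upwards [hr] with r hr
    filter_upwards [hw, hM, hd] with w hw hM hd
    have hrη : ‖(r : ℂ) * η‖ ≤ r := by
      rw [norm_mul, hη, mul_one, Complex.norm_real, Real.norm_of_nonneg hr.1.le]
    have h1 := le_norm_one_sub_mul hrη hw
    have h2 : ‖1 - η * w‖ ≤ ‖1 - r * η * w‖ + (1 - r) := by
      have heq : 1 - η * w = (1 - r * η * w) - ((1 - r : ℝ) : ℂ) * (η * w) := by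
        push_cast; ring
      rw [heq]
      refine (norm_sub_le _ _).trans ?_
      gcongr
      rw [norm_mul, norm_mul, hη, one_mul, Complex.norm_real,
        Real.norm_of_nonneg (by linarith [hr.2])]
      exact mul_le_of_le_one_right (by linarith [hr.2]) hw
    rw [norm_mul, norm_inv]
    gcongr
    · exact (norm_nonneg _).trans hM
    · linarith
  · filter_upwards [hd] with w hd
    have hne : 1 - η * w ≠ 0 := norm_pos_iff.1 (hδ.trans_le hd)
    have : ContinuousAt (fun r : ℝ => b w * (1 - r * η * w)⁻¹) 1 := by
      fun_prop (disch := simpa using hne)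
    simpa using this.tendsto.mono_left nhdsWithin_le_nhds

lemma re_invCauchy_nonneg {p : ℂ → ℝ} (hw : ∀ᵐ w ∂μ, ‖w‖ ≤ 1) (hp : Measurable p)
    (hM : ∀ᵐ w ∂μ, ‖(p w : ℂ)‖ ≤ M) (hp0 : ∀ᵐ w ∂μ, 0 ≤ p w) {u : ℂ} (hu : u ∈ ball (0 : ℂ) 1) :
    0 ≤ (invCauchy μ (fun w => p w) u).re := by
  have hu : ‖u‖ < 1 := mem_ball_zero_iff.1 hu
  have hint : Integrable (fun w => (p w : ℂ) * (1 - u * w)⁻¹) μ := by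
    refine integrable_mul_inv_of_le (sub_pos.2 hu) (by fun_prop) hM (by fun_prop) ?_
    filter_upwards [hw] with w hw using le_norm_one_sub_mul le_rfl hw
  have hre : (invCauchy μ (fun w => p w) u).re = ∫ w, ((p w : ℂ) * (1 - u * w)⁻¹).re ∂μ :=
    (integral_re hint).symm
  rw [hre]
  refine integral_nonneg_of_ae ?_
  filter_upwards [hw, hp0] with w hw hp0
  have h1 : ‖u * w‖ ≤ 1 := by
    rw [norm_mul]
    exact mul_le_one₀ hu.le (norm_nonneg _) hw
  have h2 : (u * w).re ≤ 1 := (Complex.re_le_norm _).trans h1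
  rw [Complex.re_ofReal_mul, Complex.inv_re, Complex.sub_re, Complex.one_re]
  exact mul_nonneg hp0 (div_nonneg (sub_nonneg.2 h2) (Complex.normSq_nonneg _))

lemma measurable_invCauchy (hb : Measurable b) : Measurable (invCauchy μ b) := by
  refine StronglyMeasurable.measurable ?_
  refine StronglyMeasurable.integral_prod_right (f := fun u w => b w * (1 - u * w)⁻¹) ?_
  refine Measurable.stronglyMeasurable ?_
  unfold Function.uncurry
  fun_prop

/-- If the boundary values on the unit circle of the transform of a bounded density on the closed
unit disk are integrable, then they satisfy the mean value property. -/
lemma integral_invCauchy_circle (hw : ∀ᵐ w ∂μ, ‖w‖ ≤ 1) (hb : Measurable b)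
    (hM : ∀ᵐ w ∂μ, ‖b w‖ ≤ M)
    (hd : ∀ᵐ t : ℝ, t ∈ Set.uIoc 0 (2 * Real.pi) →
      ∃ δ > 0, ∀ᵐ w ∂μ, δ ≤ ‖1 - circleMap 0 1 (-t) * w‖)
    (hint : IntervalIntegrable (fun t : ℝ => invCauchy μ b (circleMap 0 1 (-t)))
      volume 0 (2 * Real.pi)) :
    ∫ t in (0:ℝ)..(2 * Real.pi), invCauchy μ b (circleMap 0 1 (-t)) =
      2 * Real.pi * ∫ w, b w ∂μ := by
  have hlim : ∀ {c : ℂ → ℂ} {N : ℝ}, Measurable c → (∀ᵐ w ∂μ, ‖c w‖ ≤ N) →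
      ∀ᵐ t : ℝ, t ∈ Set.uIoc 0 (2 * Real.pi) →
        Tendsto (fun r : ℝ => invCauchy μ c (circleMap 0 r (-t))) (𝓝[<] 1)
          (𝓝 (invCauchy μ c (circleMap 0 1 (-t)))) := by
    intro c N hc hN
    filter_upwards [hd] with t ht htm
    obtain ⟨δ, hδ, hd⟩ := ht htm
    have := tendsto_invCauchy_radial hw hc hN (norm_circleMap_zero 1 (-t) |>.trans abs_one) hδ hd
    simpa [circleMap_zero] using this
  -- `b = p 1 - p 0 + (p 2 - p 0) * I` with nonnegative `p i`
  let p : Fin 3 → ℂ → ℝ := ![fun _ => M, fun w => M + (b w).re, fun w => M + (b w).im]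
  have hpm : ∀ i, Measurable (p i) := by
    intro i
    fin_cases i <;> simp only [p] <;> dsimp <;> fun_prop
  have hp0 : ∀ i, ∀ᵐ w ∂μ, 0 ≤ p i w := by
    intro i
    filter_upwards [hM] with w hM
    have h1 := (abs_le.1 (Complex.abs_re_le_norm (b w))).1
    have h2 := (abs_le.1 (Complex.abs_im_le_norm (b w))).1
    have h3 := norm_nonneg (b w)
    fin_cases i <;> simp [p] <;> linarith
  have hpM : ∀ i, ∀ᵐ w ∂μ, ‖(p i w : ℂ)‖ ≤ 2 * M := by
    intro i
    filter_upwards [hM, hp0 i] with w hM hp0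
    rw [Complex.norm_real, Real.norm_of_nonneg hp0]
    have h1 := Complex.re_le_norm (b w)
    have h2 := Complex.im_le_norm (b w)
    have h3 := norm_nonneg (b w)
    fin_cases i <;> simp [p] <;> linarith
  have hpc : ∀ i, Measurable fun w => (p i w : ℂ) := fun i => by
    have := hpm i
    fun_prop
  have hre := fun i u hu => re_invCauchy_nonneg (u := u) hw (hpm i) (hpM i) (hp0 i) hu
  have hzero : invCauchy μ b 0 = ∫ w, b w ∂μ := by simp [invCauchy]
  rw [← hzero]
  refine integral_radialLimit_of_le_prod (P := fun i => invCauchy μ fun w => p i w)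
    (p := fun i t => invCauchy μ (fun w => p i w) (circleMap 0 1 (-t))) (C := 4)
    (fun i => invCauchy_differentiableOn hw (hpc i) (hpM i)) hre
    (fun i => (measurable_invCauchy (hpc i)).comp
      ((continuous_circleMap 0 1).comp continuous_neg).measurable)
    (fun i => hlim (hpc i) (hpM i)) (invCauchy_differentiableOn hw hb hM) ?_ (hlim hb hM) hint
  intro u hu
  have hi : ∀ i, Integrable (fun w => (p i w : ℂ) * (1 - u * w)⁻¹) μ := by
    intro i
    refine integrable_mul_inv_of_le (sub_pos.2 (mem_ball_zero_iff.1 hu)) (hpc i) (hpM i)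
      (by fun_prop) ?_
    filter_upwards [hw] with w hw using le_norm_one_sub_mul le_rfl hw
  set Q : Fin 3 → ℂ := fun i => invCauchy μ (fun w => p i w) u with hQ
  have hsplit : invCauchy μ b u = Q 1 - Q 0 + (Q 2 - Q 0) * I := by
    simp only [hQ, invCauchy]
    have hi' : ∀ i, Integrable
        (fun w => (p i w : ℂ) * (1 - u * w)⁻¹ - (p 0 w : ℂ) * (1 - u * w)⁻¹) μ :=
      fun i => (hi i).sub (hi 0)
    rw [← integral_sub (hi 1) (hi 0), ← integral_sub (hi 2) (hi 0), ← integral_mul_const,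
      ← integral_add (hi' 1) ((hi' 2).mul_const I)]
    refine integral_congr_ae (Eventually.of_forall fun w => ?_)
    have hbw : b w = (p 1 w : ℂ) - p 0 w + (p 2 w - p 0 w) * I := by
      simp [p, Complex.re_add_im]
    simp only [hbw]
    ring
  have hQ1 : ∀ i, 1 ≤ ‖1 + Q i‖ ∧ ‖Q i‖ ≤ ‖1 + Q i‖ := by
    intro i
    have h0 : 0 ≤ (Q i).re := hre i u hu
    have h1 := one_le_norm_one_add_smul h0 zero_le_one
    simp only [Complex.ofReal_one, one_mul] at h1
    refine ⟨h1, (sq_le_sq₀ (norm_nonneg _) (norm_nonneg _)).1 ?_⟩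
    rw [← Complex.normSq_eq_norm_sq, ← Complex.normSq_eq_norm_sq, Complex.normSq_apply,
      Complex.normSq_apply]
    simp
    nlinarith
  have hnorm : ‖invCauchy μ b u‖ ≤ ‖Q 1‖ + ‖Q 0‖ + (‖Q 2‖ + ‖Q 0‖) := by
    rw [hsplit]
    refine (norm_add_le _ _).trans (add_le_add (norm_sub_le _ _) ?_)
    rw [norm_mul, Complex.norm_I, mul_one]
    exact norm_sub_le _ _
  rw [Fin.prod_univ_three]
  change _ ≤ 4 * (‖1 + Q 0‖ * ‖1 + Q 1‖ * ‖1 + Q 2‖)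
  obtain ⟨a1, a2⟩ := hQ1 0
  obtain ⟨b1, b2⟩ := hQ1 1
  obtain ⟨c1, c2⟩ := hQ1 2
  have hab := one_le_mul_of_one_le_of_one_le a1 b1
  have h1 := mul_le_mul_of_nonneg_right hab (zero_le_one.trans c1)
  have h2 := mul_le_mul_of_nonneg_left c1 (zero_le_one.trans hab)
  have h3 := mul_le_mul_of_nonneg_left b1 (zero_le_one.trans a1)
  have h4 := mul_le_mul_of_nonneg_right a1 (zero_le_one.trans b1)
  linarith

end invCauchy

lemma circleMap_neg_mul_circleMap (t : ℝ) : circleMap 0 1 (-t) * circleMap 0 1 t = 1 := by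
  simp [circleMap_zero, ← Complex.exp_add]

lemma integral_circleMap_mul_inv_sub {z : ℂ} (hz : ‖z‖ < 1) :
    ∫ t in (0:ℝ)..(2 * Real.pi), circleMap 0 1 t * (circleMap 0 1 t - z)⁻¹ = 2 * Real.pi := by
  have h := DiffContOnCl.circleAverage_smul_div (f := fun _ : ℂ => (1 : ℂ)) (c := 0) (R := 1)
    (w := z) diffContOnCl_const (by simpa using hz)
  rw [Real.circleAverage_def, Complex.real_smul] at h
  simp only [sub_zero, smul_eq_mul, mul_one, div_eq_mul_inv] at h
  push_cast at h
  rwa [inv_mul_eq_one₀ (by simp [Real.pi_ne_zero]), eq_comm] at h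

lemma integral_circleMap_mul_inv_sub_eq_zero {z : ℂ} (hz : 1 < ‖z‖) :
    ∫ t in (0:ℝ)..(2 * Real.pi), circleMap 0 1 t * (circleMap 0 1 t - z)⁻¹ = 0 := by
  have hd : ∀ u ∈ closedBall (0 : ℂ) 1, DifferentiableAt ℂ (fun u => u * (u - z)⁻¹) u := by
    intro u hu
    have hne : u - z ≠ 0 := by
      rintro h
      rw [sub_eq_zero.1 h, mem_closedBall_zero_iff] at hu
      linarith
    fun_prop (disch := exact hne)
  have h := circleAverage_of_differentiable_on_off_countable (R := 1) countable_empty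
    (by rw [abs_one]; exact fun u hu => (hd u hu).continuousAt.continuousWithinAt)
    (by rw [abs_one]; exact fun u hu => hd u (ball_subset_closedBall hu.1))
  rw [Real.circleAverage_def, Complex.real_smul, zero_mul] at h
  exact (mul_eq_zero.1 h).resolve_left (by simp [Real.pi_ne_zero])

lemma ae_circleMap_notMem_of_arcMeasure_eq_zero {K : Set ℂ} (hK : MeasurableSet K)
    (h : arcMeasure 0 1 (K ∩ sphere (0 : ℂ) 1) = 0) :
    ∀ᵐ t : ℝ, t ∈ Set.uIoc 0 (2 * Real.pi) → circleMap 0 1 t ∉ K := by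
  rw [arcMeasure, ENNReal.ofReal_one, one_smul,
    Measure.map_apply (continuous_circleMap 0 1).measurable (hK.inter isClosed_sphere.measurableSet),
    Measure.restrict_congr_set Ico_ae_eq_Ioc, ← Set.uIoc_of_le Real.two_pi_pos.le] at h
  refine (ae_restrict_iff' measurableSet_uIoc).1 ?_
  filter_upwards [measure_eq_zero_iff_ae_notMem.1 h] with t ht htK
  exact ht ⟨htK, circleMap_mem_sphere 0 zero_le_one t⟩

lemma exists_pos_le_norm_sub {K : Set ℂ} (hK : IsClosed K) {z : ℂ} (hz : z ∉ K) :
    ∃ δ > 0, ∀ w ∈ K, δ ≤ ‖w - z‖ := by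
  obtain ⟨δ, hδ, h⟩ := Metric.isOpen_iff.1 hK.isOpen_compl z hz
  refine ⟨δ, hδ, fun w hw => not_lt.1 fun hlt => h (?_ : w ∈ ball z δ) hw⟩
  rwa [mem_ball, dist_eq_norm]

namespace CMeasure

/-- The integral over the unit circle defining the Cauchy transform of the screening measure. -/
lemma integral_circle_cauchy_mul_inv_sub {K : Set ℂ} (hK : IsCompact K)
    (hKsub : K ⊆ closedBall (0 : ℂ) 1) (hKlen : arcMeasure 0 1 (K ∩ sphere (0 : ℂ) 1) = 0)
    (ν : CMeasure) (hsupp : ν.SupportedIn K)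
    (hL1 : IntervalIntegrable (fun t : ℝ => ν.cauchy (circleMap 0 1 t)) volume 0 (2 * Real.pi))
    {z : ℂ} (hzK : z ∉ K) (hz : ‖z‖ ≠ 1) :
    ∫ t in (0:ℝ)..(2 * Real.pi),
        circleMap 0 1 t * ν.cauchy (circleMap 0 1 t) * (circleMap 0 1 t - z)⁻¹ =
      ν.cauchy z *
        ((∫ t in (0:ℝ)..(2 * Real.pi), circleMap 0 1 t * (circleMap 0 1 t - z)⁻¹) -
          2 * Real.pi) := by
  have := ν.finite
  have hdm := ν.meas_density
  have hwK : ∀ᵐ w ∂ν.var, w ∈ K := hsupp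
  have hw : ∀ᵐ w ∂ν.var, ‖w‖ ≤ 1 := hwK.mono fun w hw => mem_closedBall_zero_iff.1 (hKsub hw)
  have hne : ∀ t, circleMap 0 1 t - z ≠ 0 := fun t h => hz (by simp [← sub_eq_zero.1 h])
  have hint : ∀ v ∉ K, Integrable (fun w => (w - v)⁻¹ * ν.density w) ν.var := by
    intro v hv
    obtain ⟨δ, hδ, hd⟩ := exists_pos_le_norm_sub hK.isClosed hv
    simp only [mul_comm _ (ν.density _)]
    exact integrable_mul_inv_of_le hδ hdm (ν.norm_density.mono fun w => Eq.le) (by fun_prop)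
      (hwK.mono hd)
  have hcirc : ∀ᵐ t : ℝ, t ∈ Set.uIoc 0 (2 * Real.pi) → circleMap 0 1 t ∉ K :=
    ae_circleMap_notMem_of_arcMeasure_eq_zero hK.measurableSet hKlen
  set b : ℂ → ℂ := fun w => (w - z)⁻¹ * ν.density w with hb
  have hbm : Measurable b := by fun_prop
  obtain ⟨δ, hδ, hzδ⟩ := exists_pos_le_norm_sub hK.isClosed hzK
  have hbM : ∀ᵐ w ∂ν.var, ‖b w‖ ≤ δ⁻¹ := by
    filter_upwards [hwK, ν.norm_density] with w hwK hd
    rw [norm_mul, hd, mul_one, norm_inv]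
    exact inv_anti₀ hδ (hzδ w hwK)
  have hkernel : ∀ t w, 1 - circleMap 0 1 (-t) * w =
      -(circleMap 0 1 (-t) * (w - circleMap 0 1 t)) := fun t w => by
    linear_combination -circleMap_neg_mul_circleMap t
  have hdist : ∀ᵐ t : ℝ, t ∈ Set.uIoc 0 (2 * Real.pi) →
      ∃ δ > 0, ∀ᵐ w ∂ν.var, δ ≤ ‖1 - circleMap 0 1 (-t) * w‖ := by
    filter_upwards [hcirc] with t ht htm
    obtain ⟨δ, hδ, hd⟩ := exists_pos_le_norm_sub hK.isClosed (ht htm)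
    refine ⟨δ, hδ, hwK.mono fun w hw => ?_⟩
    rw [hkernel, norm_neg, norm_mul, norm_circleMap_zero, abs_one, one_mul]
    exact hd w hw
  have hdecomp : ∀ᵐ t : ℝ, t ∈ Set.uIoc 0 (2 * Real.pi) →
      ν.cauchy z * (circleMap 0 1 t * (circleMap 0 1 t - z)⁻¹) -
        circleMap 0 1 t * ν.cauchy (circleMap 0 1 t) * (circleMap 0 1 t - z)⁻¹ =
      invCauchy ν.var b (circleMap 0 1 (-t)) := by
    filter_upwards [hcirc] with t ht htm
    have hfac : ν.cauchy z * (circleMap 0 1 t * (circleMap 0 1 t - z)⁻¹) -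
        circleMap 0 1 t * ν.cauchy (circleMap 0 1 t) * (circleMap 0 1 t - z)⁻¹ =
        circleMap 0 1 t * (circleMap 0 1 t - z)⁻¹ *
          (ν.cauchy z - ν.cauchy (circleMap 0 1 t)) := by ring
    rw [hfac, cauchy, cauchy, ← integral_sub (hint z hzK) (hint _ (ht htm)),
      ← integral_const_mul]
    refine integral_congr_ae ?_
    filter_upwards [hwK] with w hwK
    have h1 : w - z ≠ 0 := sub_ne_zero.2 fun h => hzK (h ▸ hwK)
    have h2 : w - circleMap 0 1 t ≠ 0 := sub_ne_zero.2 fun h => ht htm (h ▸ hwK)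
    have h3 := hne t
    have h4 : (circleMap 0 1 (-t))⁻¹ = circleMap 0 1 t :=
      inv_eq_of_mul_eq_one_right (circleMap_neg_mul_circleMap t)
    rw [hkernel, inv_neg, mul_inv, h4]
    simp only [hb]
    field_simp
    ring
  have hcont : Continuous fun t : ℝ => circleMap 0 1 t * (circleMap 0 1 t - z)⁻¹ :=
    (continuous_circleMap 0 1).mul (((continuous_circleMap 0 1).sub continuous_const).inv₀ hne)
  have hi1 : IntervalIntegrable
      (fun t : ℝ => ν.cauchy z * (circleMap 0 1 t * (circleMap 0 1 t - z)⁻¹))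
      volume 0 (2 * Real.pi) := (hcont.intervalIntegrable _ _).const_mul _
  have hi2 : IntervalIntegrable (fun t : ℝ =>
      circleMap 0 1 t * ν.cauchy (circleMap 0 1 t) * (circleMap 0 1 t - z)⁻¹)
      volume 0 (2 * Real.pi) :=
    (hL1.continuousOn_mul hcont.continuousOn).congr fun t _ => by ring
  have hmean := integral_invCauchy_circle hw hbm hbM hdist
    ((hi1.sub hi2).congr_ae ((ae_restrict_iff' measurableSet_uIoc).2 hdecomp))
  rw [← intervalIntegral.integral_congr_ae hdecomp, intervalIntegral.integral_sub hi1 hi2,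
    intervalIntegral.integral_const_mul] at hmean
  have hbz : ∫ w, b w ∂ν.var = ν.cauchy z := rfl
  rw [hbz] at hmean
  linear_combination -hmean

end CMeasure

/-- The unit circle as a "screen": if `ν_K` is supported on a compact `K ⊆ 𝔻̄` meeting the
circle in a set of zero arc-length and its Cauchy transform is integrable on the circle,
then adding the measure `dν_c(e^{it}) = (2π)⁻¹ e^{it} ν̂_K(e^{it}) dt` on the circle
produces a measure `ν = ν_K + ν_c` whose Cauchy transform equals `ν̂_K` inside the disk
(off `K`) and vanishes outside the closed disk. -/
theorem circle_screen (K : Set ℂ) (hKcp : IsCompact K)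
    (hKsub : K ⊆ Metric.closedBall (0 : ℂ) 1)
    (hKlen : arcMeasure 0 1 (K ∩ Metric.sphere (0 : ℂ) 1) = 0)
    (νK : CMeasure) (hsupp : νK.SupportedIn K)
    (hdef : ∀ᵐ (t : ℝ) ∂(volume.restrict (Set.Ico (0:ℝ) (2 * Real.pi))),
      MeasureTheory.Integrable
        (fun w => (w - Complex.exp ((t : ℂ) * Complex.I))⁻¹ * νK.density w) νK.var)
    (hL1 : IntervalIntegrable (fun t : ℝ => νK.cauchy (Complex.exp ((t : ℂ) * Complex.I)))
      MeasureTheory.volume 0 (2 * Real.pi)) :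
    -- the Cauchy transform of `ν = ν_K + ν_c` is `ν̂_K(z) + (2π)⁻¹ ∫₀^{2π} e^{it} ν̂_K(e^{it}) (e^{it}-z)⁻¹ dt`
    (∀ z ∈ Metric.ball (0 : ℂ) 1, z ∉ K →
      νK.cauchy z + (2 * Real.pi : ℂ)⁻¹ *
        (∫ t in (0:ℝ)..(2 * Real.pi), Complex.exp ((t : ℂ) * Complex.I) *
          νK.cauchy (Complex.exp ((t : ℂ) * Complex.I)) * (Complex.exp ((t : ℂ) * Complex.I) - z)⁻¹)
        = νK.cauchy z) ∧
    (∀ z : ℂ, 1 < ‖z‖ →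
      νK.cauchy z + (2 * Real.pi : ℂ)⁻¹ *
        (∫ t in (0:ℝ)..(2 * Real.pi), Complex.exp ((t : ℂ) * Complex.I) *
          νK.cauchy (Complex.exp ((t : ℂ) * Complex.I)) * (Complex.exp ((t : ℂ) * Complex.I) - z)⁻¹)
        = 0) := by
  have hexp : ∀ t : ℝ, Complex.exp ((t : ℂ) * Complex.I) = circleMap 0 1 t := fun t => by
    simp [circleMap_zero]
  simp only [hexp] at hL1 ⊢
  have hpi : (2 * Real.pi : ℂ) ≠ 0 := by simp [Real.pi_ne_zero]
  refine ⟨fun z hz hzK => ?_, fun z hz => ?_⟩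
  · have hz : ‖z‖ < 1 := mem_ball_zero_iff.1 hz
    rw [νK.integral_circle_cauchy_mul_inv_sub hKcp hKsub hKlen hsupp hL1 hzK hz.ne,
      integral_circleMap_mul_inv_sub hz, sub_self, mul_zero, mul_zero, add_zero]
  · have hzK : z ∉ K := fun h => hz.not_ge (mem_closedBall_zero_iff.1 (hKsub h))
    rw [νK.integral_circle_cauchy_mul_inv_sub hKcp hKsub hKlen hsupp hL1 hzK hz.ne',
      integral_circleMap_mul_inv_sub_eq_zero hz]
    field_simp
    ring
end

section
/- Fix a ∈ ℂ with |a| < 1. Let δ_a be the Dirac point mass at a, let ν_c be the measure on S¹ defined by dν_c(e^{it}) = (1/2π) e^{it} (a − e^{it})⁻¹ dt, and set ν = δ_a + ν_c. Then ν̂(z) = (a − z)⁻¹ for every z in the open unit disk with z ≠ a, and ν̂(z) = 0 for every z with |z| > 1. In particular, there exists a finite complex measure with an atom, supported on the compact nowhere dense set {a} ∪ S¹, whose Cauchy transform vanishes everywhere outside the closed unit disk. -/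
open MeasureTheory Filter Set Metric Complex Topology
open scoped ENNReal NNReal

namespace CMeasure

/-- The complex measure `h μ`, in polar form. -/
noncomputable def ofDensity (μ : Measure ℂ) (h : ℂ → ℂ) (hm : Measurable h)
    (hi : Integrable h μ) : CMeasure where
  var := μ.withDensity fun w => (‖h w‖₊ : ℝ≥0∞)
  density w := if h w = 0 then 1 else h w / (‖h w‖ : ℂ)
  finite := isFiniteMeasure_withDensity hi.2.ne
  meas_density := Measurable.ite (hm (measurableSet_singleton 0)) measurable_const
    (hm.div (Complex.measurable_ofReal.comp hm.norm))
  norm_density := by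
    refine Eventually.of_forall fun w => ?_
    by_cases hw : h w = 0
    · simp [hw]
    · simp [hw, div_self]

theorem cauchy_ofDensity (μ : Measure ℂ) (h : ℂ → ℂ) (hm : Measurable h)
    (hi : Integrable h μ) (z : ℂ) :
    (ofDensity μ h hm hi).cauchy z = ∫ w, (w - z)⁻¹ * h w ∂μ := by
  simp only [cauchy, ofDensity]
  rw [integral_withDensity_eq_integral_smul hm.nnnorm]
  refine integral_congr_ae (Eventually.of_forall fun w => ?_)
  by_cases hw : h w = 0
  · simp [hw]
  · have : (‖h w‖ : ℂ) ≠ 0 := by simpa using hw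
    simp only [hw, if_false, NNReal.smul_def, coe_nnnorm, Complex.real_smul]
    field_simp

end CMeasure

theorem integrable_arcMeasure {f : ℂ → ℂ} (hf : Measurable f) {c : ℂ} {r : ℝ} (hr : 0 ≤ r)
    (hc : ContinuousOn f (sphere c r)) : Integrable f (arcMeasure c r) := by
  refine Integrable.smul_measure ?_ ENNReal.ofReal_ne_top
  rw [integrable_map_measure hf.aestronglyMeasurable (measurable_circleMap c r).aemeasurable]
  have h : Continuous (f ∘ circleMap c r) :=
    hc.comp_continuous (continuous_circleMap c r) (circleMap_mem_sphere c hr)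
  exact (h.continuousOn.integrableOn_Icc (a := 0) (b := 2 * Real.pi)).mono_set Ico_subset_Icc_self

theorem integral_arcMeasure {f : ℂ → ℂ} (hf : Measurable f) (c : ℂ) {r : ℝ} (hr : 0 ≤ r) :
    ∫ w, f w ∂arcMeasure c r = r • ∫ t in (0 : ℝ)..(2 * Real.pi), f (circleMap c r t) := by
  rw [arcMeasure, integral_smul_measure, ENNReal.toReal_ofReal hr,
    integral_map (measurable_circleMap c r).aemeasurable hf.aestronglyMeasurable,
    intervalIntegral.integral_of_le Real.two_pi_pos.le, integral_Ico_eq_integral_Ioo,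
    integral_Ioc_eq_integral_Ioo]

theorem arcMeasure_compl_sphere (c : ℂ) {r : ℝ} (hr : 0 ≤ r) :
    arcMeasure c r (sphere c r)ᶜ = 0 := by
  have h : circleMap c r ⁻¹' (sphere c r)ᶜ = ∅ := by
    ext t
    simpa using abs_of_nonneg hr
  simp [arcMeasure, Measure.map_apply (measurable_circleMap c r)
    isClosed_sphere.measurableSet.compl, h]

theorem circleIntegral_inv_sub_eq_zero {c z : ℂ} {r : ℝ} (hr : 0 ≤ r) (hz : r < dist z c) :
    (∮ w in C(c, r), (w - z)⁻¹) = 0 := by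
  have hne : ∀ w ∈ closedBall c r, w - z ≠ 0 := fun w hw h => by
    rw [sub_eq_zero.1 h, mem_closedBall] at hw
    exact hw.not_gt hz
  refine circleIntegral_eq_zero_of_differentiable_on_off_countable hr countable_empty ?_ ?_
  · exact (continuousOn_id.sub continuousOn_const).inv₀ hne
  · intro w hw
    exact (differentiableAt_id.sub_const z).inv (hne w (ball_subset_closedBall hw.1))

theorem continuousOn_inv_sub_sphere {c z : ℂ} {r : ℝ} (hz : dist z c ≠ r) :
    ContinuousOn (fun w : ℂ => (w - z)⁻¹) (sphere c r) := by
  refine (continuousOn_id.sub continuousOn_const).inv₀ fun w hw h => hz ?_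
  rwa [mem_sphere, show w = z from sub_eq_zero.1 h] at hw

/-- Partial fractions for the Cauchy transform of `w (a - w)⁻¹ dt` on the unit circle. -/
theorem integral_screen (a z : ℂ) (ha : ‖a‖ < 1) (hz : ‖z‖ ≠ 1) (hza : z ≠ a) :
    (∫ t in (0 : ℝ)..(2 * Real.pi), exp ((t : ℂ) * I) * (a - exp ((t : ℂ) * I))⁻¹ *
        (exp ((t : ℂ) * I) - z)⁻¹) =
      I⁻¹ * (a - z)⁻¹ * ((∮ w in C(0, 1), (w - z)⁻¹) - 2 * Real.pi * I) := by
  have hI : ∀ u : ℂ, dist u 0 ≠ 1 → CircleIntegrable (fun w => (w - u)⁻¹) 0 1 := fun u hu =>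
    (continuousOn_inv_sub_sphere hu).circleIntegrable zero_le_one
  have ha' : dist a 0 ≠ 1 := by simpa using ha.ne
  have hz' : dist z 0 ≠ 1 := by simpa using hz
  rw [← circleIntegral.integral_sub_inv_of_mem_ball (c := 0) (R := 1) (w := a) (by simpa using ha),
    ← circleIntegral.integral_sub (hI z hz') (hI a ha'), circleIntegral,
    ← intervalIntegral.integral_const_mul]
  refine intervalIntegral.integral_congr fun t _ => ?_
  have hn : ‖exp ((t : ℂ) * I)‖ = 1 := norm_exp_ofReal_mul_I t
  have h1 : exp ((t : ℂ) * I) - z ≠ 0 := fun h => hz (by rw [← sub_eq_zero.1 h, hn])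
  have h2 : a - exp ((t : ℂ) * I) ≠ 0 := fun h => ha.ne (by rw [sub_eq_zero.1 h, hn])
  have h3 : a - z ≠ 0 := sub_ne_zero.2 hza.symm
  simp only [deriv_circleMap, circleMap, ofReal_one, one_mul, zero_add, smul_eq_mul]
  generalize exp ((t : ℂ) * I) = w at *
  have h4 : (w - z)⁻¹ - (w - a)⁻¹ = (a - z) * ((a - w)⁻¹ * (w - z)⁻¹) := by
    rw [← neg_sub a w, inv_neg]
    field_simp
    ring
  rw [h4]
  field_simp

theorem integral_screen_of_mem_ball (a z : ℂ) (ha : ‖a‖ < 1) (hz : ‖z‖ < 1) (hza : z ≠ a) :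
    (∫ t in (0 : ℝ)..(2 * Real.pi), exp ((t : ℂ) * I) * (a - exp ((t : ℂ) * I))⁻¹ *
        (exp ((t : ℂ) * I) - z)⁻¹) = 0 := by
  rw [integral_screen a z ha hz.ne hza,
    circleIntegral.integral_sub_inv_of_mem_ball (by simpa using hz), sub_self, mul_zero]

theorem integral_screen_of_one_lt_norm (a z : ℂ) (ha : ‖a‖ < 1) (hz : 1 < ‖z‖) :
    (∫ t in (0 : ℝ)..(2 * Real.pi), exp ((t : ℂ) * I) * (a - exp ((t : ℂ) * I))⁻¹ *
        (exp ((t : ℂ) * I) - z)⁻¹) = -(2 * Real.pi * (a - z)⁻¹) := by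
  have hza : z ≠ a := fun h => (ha.trans hz).ne (by rw [h])
  rw [integral_screen a z ha hz.ne' hza,
    circleIntegral_inv_sub_eq_zero zero_le_one (by simpa using hz)]
  field_simp [I_ne_zero]
  ring

/-- The density of `δ_a + ν_c` with respect to `δ_a + arcMeasure 0 1`. -/
noncomputable def screenDensity (a w : ℂ) : ℂ :=
  if w = a then 1 else (2 * Real.pi : ℂ)⁻¹ * (w * (a - w)⁻¹)

theorem measurable_screenDensity (a : ℂ) : Measurable (screenDensity a) :=
  Measurable.ite (measurableSet_singleton a) measurable_const (by fun_prop)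

theorem continuousOn_screenDensity {a : ℂ} (ha : ‖a‖ < 1) :
    ContinuousOn (screenDensity a) (sphere 0 1) := by
  have hne : ∀ w ∈ sphere (0 : ℂ) 1, w ≠ a := fun w hw h => ha.ne (by simpa [h] using hw)
  refine ContinuousOn.congr (f := fun w => (2 * Real.pi : ℂ)⁻¹ * (w * (a - w)⁻¹)) ?_
    fun w hw => if_neg (hne w hw)
  exact continuousOn_const.mul (continuousOn_id.mul ((continuousOn_const.sub continuousOn_id).inv₀
    fun w hw => sub_ne_zero.2 (hne w hw).symm))

theorem integrable_screenDensity {a : ℂ} (ha : ‖a‖ < 1) :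
    Integrable (screenDensity a) (Measure.dirac a + arcMeasure 0 1) :=
  (integrable_dirac (by finiteness)).add_measure (integrable_arcMeasure
    (measurable_screenDensity a) zero_le_one (continuousOn_screenDensity ha))

/-- The measure `δ_a + ν_c`. -/
noncomputable def screenMeasure (a : ℂ) (ha : ‖a‖ < 1) : CMeasure :=
  CMeasure.ofDensity (Measure.dirac a + arcMeasure 0 1) (screenDensity a)
    (measurable_screenDensity a) (integrable_screenDensity ha)

theorem supportedIn_screenMeasure (a : ℂ) (ha : ‖a‖ < 1) :
    (screenMeasure a ha).SupportedIn ({a} ∪ sphere 0 1) := by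
  refine withDensity_absolutelyContinuous _ _ ?_
  rw [Measure.add_apply, measure_mono_null (compl_subset_compl.2 subset_union_right)
    (arcMeasure_compl_sphere 0 zero_le_one)]
  simp

theorem screenMeasure_var_singleton_ne_zero (a : ℂ) (ha : ‖a‖ < 1) :
    (screenMeasure a ha).var {a} ≠ 0 := by
  simp [screenMeasure, CMeasure.ofDensity, screenDensity]

theorem cauchy_screenMeasure (a z : ℂ) (ha : ‖a‖ < 1) (hz : ‖z‖ ≠ 1) :
    (screenMeasure a ha).cauchy z = (a - z)⁻¹ + (2 * Real.pi : ℂ)⁻¹ *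
      (∫ t in (0 : ℝ)..(2 * Real.pi), exp ((t : ℂ) * I) * (a - exp ((t : ℂ) * I))⁻¹ *
        (exp ((t : ℂ) * I) - z)⁻¹) := by
  have hm : Measurable fun w => (w - z)⁻¹ * screenDensity a w :=
    (measurable_id.sub_const z).inv.mul (measurable_screenDensity a)
  rw [screenMeasure, CMeasure.cauchy_ofDensity, integral_add_measure
    (integrable_dirac (by finiteness)) (integrable_arcMeasure hm zero_le_one
      ((continuousOn_inv_sub_sphere (by simpa using hz)).mul (continuousOn_screenDensity ha))),
    integral_dirac, integral_arcMeasure hm 0 zero_le_one, one_smul,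
    ← intervalIntegral.integral_const_mul]
  congr 1
  · simp [screenDensity]
  · refine intervalIntegral.integral_congr fun t _ => ?_
    have hn : ‖exp ((t : ℂ) * I)‖ = 1 := norm_exp_ofReal_mul_I t
    have h2 : exp ((t : ℂ) * I) ≠ a := fun h => ha.ne (by rw [← h, hn])
    simp only [circleMap, ofReal_one, one_mul, zero_add, screenDensity, if_neg h2]
    ring

theorem interior_singleton_union_sphere (a : ℂ) :
    interior ({a} ∪ sphere (0 : ℂ) 1) = ∅ := by
  rw [interior_union_isClosed_of_interior_empty isClosed_singleton
    (interior_sphere (0 : ℂ) one_ne_zero), interior_singleton]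


/-- For `|a| < 1`, the measure `ν = δ_a + ν_c` with `dν_c(e^{it}) = (2π)⁻¹ e^{it}(a − e^{it})⁻¹ dt`
has Cauchy transform `(a − z)⁻¹` in the disk (for `z ≠ a`) and `0` outside the closed disk.
In particular there is a finite complex measure with an atom, supported on the nowhere dense
compact `{a} ∪ S¹`, whose Cauchy transform vanishes outside the closed unit disk. -/
theorem dirac_screen (a : ℂ) (ha : ‖a‖ < 1) :
    (∀ z ∈ Metric.ball (0 : ℂ) 1, z ≠ a →
      (a - z)⁻¹ + (2 * Real.pi : ℂ)⁻¹ *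
        (∫ t in (0:ℝ)..(2 * Real.pi), Complex.exp ((t : ℂ) * Complex.I) *
          (a - Complex.exp ((t : ℂ) * Complex.I))⁻¹ *
          (Complex.exp ((t : ℂ) * Complex.I) - z)⁻¹)
        = (a - z)⁻¹) ∧
    (∀ z : ℂ, 1 < ‖z‖ →
      (a - z)⁻¹ + (2 * Real.pi : ℂ)⁻¹ *
        (∫ t in (0:ℝ)..(2 * Real.pi), Complex.exp ((t : ℂ) * Complex.I) *
          (a - Complex.exp ((t : ℂ) * Complex.I))⁻¹ *
          (Complex.exp ((t : ℂ) * Complex.I) - z)⁻¹)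
        = 0) ∧
    (∃ ν : CMeasure, ν.SupportedIn ({a} ∪ Metric.sphere (0 : ℂ) 1) ∧
      interior ({a} ∪ Metric.sphere (0 : ℂ) 1) = ∅ ∧
      ν.var {a} ≠ 0 ∧
      ∀ z : ℂ, 1 < ‖z‖ → ν.cauchy z = 0) := by
  have hout : ∀ z : ℂ, 1 < ‖z‖ →
      (a - z)⁻¹ + (2 * Real.pi : ℂ)⁻¹ *
        (∫ t in (0 : ℝ)..(2 * Real.pi), exp ((t : ℂ) * I) * (a - exp ((t : ℂ) * I))⁻¹ *
          (exp ((t : ℂ) * I) - z)⁻¹) = 0 := fun z hz => by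
    have hpi : (2 * Real.pi : ℂ) ≠ 0 := by simp [Real.pi_ne_zero]
    rw [integral_screen_of_one_lt_norm a z ha hz, mul_neg, inv_mul_cancel_left₀ hpi,
      add_neg_cancel]
  refine ⟨fun z hz hza => ?_, hout, screenMeasure a ha, supportedIn_screenMeasure a ha,
    interior_singleton_union_sphere a, screenMeasure_var_singleton_ne_zero a ha, fun z hz => ?_⟩
  · rw [integral_screen_of_mem_ball a z ha (by simpa using hz) hza, mul_zero, add_zero]
  · rw [cauchy_screenMeasure a z ha hz.ne', hout z hz]
end

section
/- Let K ⊂ ℂ be a compact set with empty interior and let μ be a finite complex Borel measure supported on K. Suppose that for some point x ∈ K there is an open neighborhood W of x such that K ∩ \overline{W} is a C-compact and μ̂(z) = 0 for every z ∈ W \ K. Then |μ|(W) = 0, i.e., the total variation measure of μ vanishes on W. -/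
open MeasureTheory Filter Set Metric Complex Topology
open scoped ENNReal NNReal

/-- The Cauchy kernels with pole off `L`, as a continuous family of continuous functions on `L`. -/
noncomputable def cauchyKernel (L : Set ℂ) : C((Lᶜ : Set ℂ), C(L, ℂ)) :=
  ContinuousMap.curry
    ⟨fun p : (Lᶜ : Set ℂ) × L => ((p.2 : ℂ) - p.1)⁻¹, by
      refine Continuous.inv₀ (by fun_prop) ?_
      rintro ⟨⟨z, hz⟩, ⟨w, hw⟩⟩ h
      have h' : w - z = 0 := h
      exact hz (sub_eq_zero.mp h' ▸ hw)⟩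

@[simp] lemma cauchyKernel_apply (L : Set ℂ) (z : (Lᶜ : Set ℂ)) (w : L) :
    cauchyKernel L z w = ((w : ℂ) - z)⁻¹ := rfl

/-- The closed linear span of the Cauchy kernels with poles off `L`. -/
noncomputable def cauchySpan (L : Set ℂ) [CompactSpace L] : Submodule ℂ C(L, ℂ) :=
  (Submodule.span ℂ (range (cauchyKernel L))).topologicalClosure

lemma cauchyKernel_mem_cauchySpan (L : Set ℂ) [CompactSpace L] (z : (Lᶜ : Set ℂ)) :
    cauchyKernel L z ∈ cauchySpan L :=
  Submodule.le_topologicalClosure _ (Submodule.subset_span ⟨z, rfl⟩)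

lemma mul_mem_cauchySpan (L : Set ℂ) [CompactSpace L] (f : C(L, ℂ))
    (hf : ∀ z, f * cauchyKernel L z ∈ cauchySpan L) {g : C(L, ℂ)} (hg : g ∈ cauchySpan L) :
    f * g ∈ cauchySpan L := by
  have hclosed : IsClosed (cauchySpan L : Set C(L, ℂ)) := Submodule.isClosed_topologicalClosure _
  have hle : cauchySpan L ≤ (cauchySpan L).comap (LinearMap.mulLeft ℂ f) := by
    refine Submodule.topologicalClosure_minimal _ (Submodule.span_le.mpr ?_) ?_
    · rintro _ ⟨z, rfl⟩
      exact hf z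
    · exact hclosed.preimage (continuous_const.mul continuous_id)
  exact hle hg

lemma one_mem_cauchySpan (L : Set ℂ) [CompactSpace L] : (1 : C(L, ℂ)) ∈ cauchySpan L := by
  have hL : IsCompact L := isCompact_iff_compactSpace.mpr inferInstance
  have hclosed : IsClosed (cauchySpan L : Set C(L, ℂ)) := Submodule.isClosed_topologicalClosure _
  rw [← SetLike.mem_coe, ← hclosed.closure_eq, Metric.mem_closure_iff]
  intro ε hε
  obtain ⟨M, hM, hLM⟩ := hL.isBounded.exists_pos_norm_le
  set t : ℝ := M + 2 * M / ε with ht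
  have htM : M < t := by rw [ht]; have : 0 < 2 * M / ε := by positivity
                         linarith
  have hz : (t : ℂ) ∈ Lᶜ := by
    intro h
    have := hLM _ h
    rw [Complex.norm_real, Real.norm_eq_abs, abs_of_pos (hM.trans htM)] at this
    linarith
  refine ⟨(-(t : ℂ)) • cauchyKernel L ⟨t, hz⟩,
    Submodule.smul_mem _ _ (cauchyKernel_mem_cauchySpan L _), ?_⟩
  refine lt_of_le_of_lt ((ContinuousMap.dist_le (half_pos hε).le).mpr ?_) (half_lt_self hε)
  intro w
  have hw := hLM _ w.2
  have hne : (w : ℂ) - t ≠ 0 := fun h => hz (by rw [← sub_eq_zero.mp h]; exact w.2)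
  have hlow : 2 * M / ε ≤ ‖(w : ℂ) - t‖ := by
    have := norm_sub_norm_le (t : ℂ) w
    rw [Complex.norm_real, Real.norm_eq_abs, abs_of_pos (hM.trans htM), norm_sub_rev] at this
    linarith
  have hval : (1 : C(L, ℂ)) w - ((-(t : ℂ)) • cauchyKernel L ⟨t, hz⟩) w = w / ((w : ℂ) - t) := by
    simp only [ContinuousMap.one_apply, ContinuousMap.smul_apply, cauchyKernel_apply, smul_eq_mul]
    field_simp
    ring
  rw [dist_eq_norm, hval, norm_div, div_le_iff₀ (norm_pos_iff.mpr hne)]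
  calc ‖(w : ℂ)‖ ≤ M := hw
    _ = ε / 2 * (2 * M / ε) := by field_simp
    _ ≤ _ := by gcongr

lemma cauchyKernel_mul_mem_cauchySpan (L : Set ℂ) [CompactSpace L] (a : (Lᶜ : Set ℂ))
    {g : C(L, ℂ)} (hg : g ∈ cauchySpan L) : cauchyKernel L a * g ∈ cauchySpan L := by
  have hL : IsClosed L := (isCompact_iff_compactSpace.mpr inferInstance : IsCompact L).isClosed
  have hclosed : IsClosed (cauchySpan L : Set C(L, ℂ)) := Submodule.isClosed_topologicalClosure _
  refine mul_mem_cauchySpan L _ (fun z => ?_) hg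
  have hS : IsClosed {z : (Lᶜ : Set ℂ) | cauchyKernel L a * cauchyKernel L z ∈ cauchySpan L} :=
    hclosed.preimage (continuous_const.mul (cauchyKernel L).continuous)
  have hd : Dense ({(a : ℂ)}ᶜ : Set ℂ) := dense_compl_singleton _
  have hd' := hd.preimage hL.isOpen_compl.isOpenMap_subtype_val
  have hsub : ((↑) ⁻¹' ({(a : ℂ)}ᶜ : Set ℂ) : Set (Lᶜ : Set ℂ)) ⊆
      {z : (Lᶜ : Set ℂ) | cauchyKernel L a * cauchyKernel L z ∈ cauchySpan L} := by
    intro z hz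
    have hza : (a : ℂ) - z ≠ 0 := fun h => hz (sub_eq_zero.mp h).symm
    have : cauchyKernel L a * cauchyKernel L z =
        ((a : ℂ) - z)⁻¹ • (cauchyKernel L a - cauchyKernel L z) := by
      ext w
      have h1 : (w : ℂ) - a ≠ 0 := fun h => a.2 (by rw [← sub_eq_zero.mp h]; exact w.2)
      have h2 : (w : ℂ) - z ≠ 0 := fun h => z.2 (by rw [← sub_eq_zero.mp h]; exact w.2)
      simp only [ContinuousMap.mul_apply, cauchyKernel_apply, ContinuousMap.smul_apply,
        ContinuousMap.sub_apply, smul_eq_mul]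
      field_simp
      ring
    rw [mem_ofPred_eq, this]
    exact Submodule.smul_mem _ _ (Submodule.sub_mem _ (cauchyKernel_mem_cauchySpan L _)
      (cauchyKernel_mem_cauchySpan L _))
  exact closure_minimal hsub hS (hd' z)

lemma id_mul_mem_cauchySpan (L : Set ℂ) [CompactSpace L]
    {g : C(L, ℂ)} (hg : g ∈ cauchySpan L) :
    ContinuousMap.restrict L (ContinuousMap.id ℂ) * g ∈ cauchySpan L := by
  refine mul_mem_cauchySpan L _ (fun z => ?_) hg
  have : ContinuousMap.restrict L (ContinuousMap.id ℂ) * cauchyKernel L z =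
      1 + (z : ℂ) • cauchyKernel L z := by
    ext w
    have h2 : (w : ℂ) - z ≠ 0 := fun h => z.2 (by rw [← sub_eq_zero.mp h]; exact w.2)
    simp
    field_simp
    ring
  rw [this]
  exact Submodule.add_mem _ (one_mem_cauchySpan L)
    (Submodule.smul_mem _ _ (cauchyKernel_mem_cauchySpan L _))

lemma polynomial_mul_mem_cauchySpan (L : Set ℂ) [CompactSpace L] (P : Polynomial ℂ)
    {g : C(L, ℂ)} (hg : g ∈ cauchySpan L) :
    P.toContinuousMapOn L * g ∈ cauchySpan L := by
  induction P using Polynomial.induction_on' generalizing g with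
  | add p q hp hq =>
    have : (p + q).toContinuousMapOn L * g =
        p.toContinuousMapOn L * g + q.toContinuousMapOn L * g := by
      ext w; simp [add_mul]
    rw [this]
    exact Submodule.add_mem _ (hp hg) (hq hg)
  | monomial n a =>
    induction n generalizing g with
    | zero =>
      have : (Polynomial.monomial 0 a).toContinuousMapOn L * g = a • g := by
        ext w; simp
      rw [this]
      exact Submodule.smul_mem _ _ hg
    | succ n ih =>
      have : (Polynomial.monomial (n + 1) a).toContinuousMapOn L * g =
          (Polynomial.monomial n a).toContinuousMapOn L *
            (ContinuousMap.restrict L (ContinuousMap.id ℂ) * g) := by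
        ext w; simp [pow_succ]; ring
      rw [this]
      exact ih (id_mul_mem_cauchySpan L hg)

lemma inv_multiset_prod_mem_cauchySpan (L : Set ℂ) [CompactSpace L] (s : Multiset ℂ)
    (hs : ∀ a ∈ s, a ∉ L) :
    ∃ g ∈ cauchySpan L, ∀ w : L, g w = ((s.map fun a => (w : ℂ) - a).prod)⁻¹ := by
  induction s using Multiset.induction_on with
  | empty => exact ⟨1, one_mem_cauchySpan L, by simp⟩
  | cons a s ih =>
    obtain ⟨g, hg, hgs⟩ := ih fun b hb => hs b (Multiset.mem_cons_of_mem hb)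
    refine ⟨_, cauchyKernel_mul_mem_cauchySpan L ⟨a, hs a (Multiset.mem_cons_self a s)⟩ hg, ?_⟩
    intro w
    simp [hgs, mul_comm]

lemma IsCCompact.restrict_mem_cauchySpan {L : Set ℂ} [CompactSpace L]
    (h : IsCCompact L) (f : C(ℂ, ℂ)) : f.restrict L ∈ cauchySpan L := by
  have hclosed : IsClosed (cauchySpan L : Set C(L, ℂ)) := Submodule.isClosed_topologicalClosure _
  rw [← SetLike.mem_coe, ← hclosed.closure_eq, Metric.mem_closure_iff]
  intro ε hε
  obtain ⟨g, ⟨P, Q, hQ, hg⟩, hfg⟩ := h.2.2 f f.continuous.continuousOn (ε / 2) (half_pos hε)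
  by_cases hQ0 : Q = 0
  · refine ⟨0, Submodule.zero_mem _,
      lt_of_le_of_lt ((ContinuousMap.dist_le (half_pos hε).le).mpr ?_) (half_lt_self hε)⟩
    intro w
    exact absurd (by simp [hQ0]) (hQ w w.2)
  obtain ⟨q, hq, hqs⟩ := inv_multiset_prod_mem_cauchySpan L Q.roots fun a ha haL =>
    hQ a haL (Polynomial.mem_roots hQ0 |>.mp ha)
  refine ⟨Q.leadingCoeff⁻¹ • (P.toContinuousMapOn L * q),
    Submodule.smul_mem _ _ (polynomial_mul_mem_cauchySpan L P hq),
    lt_of_le_of_lt ((ContinuousMap.dist_le (half_pos hε).le).mpr ?_) (half_lt_self hε)⟩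
  intro w
  have hQw : Q.eval (w : ℂ) = Q.leadingCoeff * (Q.roots.map fun a => (w : ℂ) - a).prod := by
    conv_lhs => rw [(IsAlgClosed.splits Q).eq_prod_roots]
    simp [Polynomial.eval_multiset_prod]
  have : (Q.leadingCoeff⁻¹ • (P.toContinuousMapOn L * q)) w = g w := by
    rw [hg w w.2, hQw]
    simp [hqs, div_eq_mul_inv]
    ring
  rw [this, dist_eq_norm]
  exact (hfg w w.2).le

lemma lintegral_inv_ball_lt_top : ∫⁻ u in ball (0 : ℂ) 1, ‖u⁻¹‖ₑ < ∞ := by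
  have : IntegrableOn (fun u : ℂ => u⁻¹) (ball 0 1) := by
    refine integrableOn_ball_of_norm_le_rpow (C := 1) (α := 1) (by simp) (by simp) ?_
      (measurable_id.inv.aestronglyMeasurable)
    exact Eventually.of_forall fun u => by simp [Real.rpow_neg_one]
  exact this.2

lemma lintegral_cauchy_bounded {h : ℂ → ℂ} (hm : Measurable h) (hi : Integrable h) {C : ℝ≥0}
    (hC : ∀ u, ‖h u‖ₑ ≤ C) :
    ∃ M : ℝ≥0∞, M < ∞ ∧ ∀ w, ∫⁻ u, ‖h u * (u - w)⁻¹‖ₑ ≤ M := by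
  refine ⟨C * (∫⁻ u in ball (0 : ℂ) 1, ‖u⁻¹‖ₑ) + ∫⁻ u, ‖h u‖ₑ,
    ENNReal.add_lt_top.mpr ⟨ENNReal.mul_lt_top ENNReal.coe_lt_top lintegral_inv_ball_lt_top, hi.2⟩,
    fun w => ?_⟩
  have key : ∀ u, ‖h u * (u - w)⁻¹‖ₑ ≤
      C * (ball (0 : ℂ) 1).indicator (fun u => ‖u⁻¹‖ₑ) (u - w) + ‖h u‖ₑ := by
    intro u
    rw [enorm_mul]
    by_cases hu : u - w ∈ ball (0 : ℂ) 1
    · rw [indicator_of_mem hu]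
      exact le_add_right (by gcongr; exact hC u)
    · refine le_add_left ?_
      have h1 : 1 ≤ ‖u - w‖ := by simpa using hu
      have : ‖(u - w)⁻¹‖ₑ ≤ 1 := by
        rw [← ofReal_norm, norm_inv]
        exact ENNReal.ofReal_le_one.mpr (inv_le_one_of_one_le₀ h1)
      calc ‖h u‖ₑ * ‖(u - w)⁻¹‖ₑ ≤ ‖h u‖ₑ * 1 := by gcongr
        _ = _ := mul_one _
  have hmi : Measurable ((ball (0 : ℂ) 1).indicator fun u => ‖u⁻¹‖ₑ) :=
    (measurable_id.inv.enorm).indicator measurableSet_ball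
  refine (lintegral_mono key).trans ?_
  rw [lintegral_add_right _ hm.enorm, lintegral_const_mul' _ _ ENNReal.coe_ne_top,
    lintegral_sub_right_eq_self (fun u => (ball (0 : ℂ) 1).indicator (fun u => ‖u⁻¹‖ₑ) u) w,
    lintegral_indicator measurableSet_ball]

lemma integrable_mul_cauchy {h : ℂ → ℂ} (hm : Measurable h) (hi : Integrable h) {C : ℝ≥0}
    (hC : ∀ u, ‖h u‖ₑ ≤ C) (w : ℂ) : Integrable fun u => h u * (u - w)⁻¹ := by
  obtain ⟨M, hM, hle⟩ := lintegral_cauchy_bounded hm hi hC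
  exact ⟨(hm.mul (measurable_id.sub_const w).inv).aestronglyMeasurable, (hle w).trans_lt hM⟩

lemma integrable_prod_cauchy {h : ℂ → ℂ} (hm : Measurable h) (hi : Integrable h) {C : ℝ≥0}
    (hC : ∀ u, ‖h u‖ₑ ≤ C) {ν : Measure ℂ} [IsFiniteMeasure ν] {k : ℂ → ℂ} (hk : Measurable k)
    (hki : Integrable k ν) :
    Integrable (fun p : ℂ × ℂ => k p.1 * (h p.2 * (p.2 - p.1)⁻¹)) (ν.prod volume) := by
  obtain ⟨M, hM, hle⟩ := lintegral_cauchy_bounded hm hi hC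
  have hmeas : Measurable fun p : ℂ × ℂ => k p.1 * (h p.2 * (p.2 - p.1)⁻¹) := by fun_prop
  refine ⟨hmeas.aestronglyMeasurable, ?_⟩
  rw [HasFiniteIntegral, lintegral_prod _ hmeas.enorm.aemeasurable]
  calc ∫⁻ w, (∫⁻ u, ‖k w * (h u * (u - w)⁻¹)‖ₑ) ∂ν
      ≤ ∫⁻ w, ‖k w‖ₑ * M ∂ν := by
        refine lintegral_mono fun w => ?_
        simp_rw [enorm_mul (k w)]
        rw [lintegral_const_mul' _ _ enorm_ne_top]
        gcongr
        exact hle w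
    _ = (∫⁻ w, ‖k w‖ₑ ∂ν) * M := lintegral_mul_const' _ _ hM.ne
    _ < ∞ := ENNReal.mul_lt_top hki.2 hM

/-- Vitushkin localization: if `φ` is the Cauchy transform of `h`, then the Cauchy transform of
`φ ν + h ν̂ dA` is `φ ν̂`. -/
lemma cauchy_localization {h : ℂ → ℂ} (hm : Measurable h) (hi : Integrable h) {C : ℝ≥0}
    (hC : ∀ u, ‖h u‖ₑ ≤ C) {ν : Measure ℂ} [IsFiniteMeasure ν] {k : ℂ → ℂ} (hk : Measurable k)
    (hki : Integrable k ν) {z : ℂ} {δ : ℝ} (hδ : 0 < δ) (hz : ∀ᵐ w ∂ν, δ ≤ ‖w - z‖) :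
    (∫ w, (w - z)⁻¹ * (k w * ∫ u, h u * (u - w)⁻¹) ∂ν) +
        ∫ u, (u - z)⁻¹ * (h u * ∫ w, (w - u)⁻¹ * k w ∂ν) =
      (∫ u, h u * (u - z)⁻¹) * ∫ w, (w - z)⁻¹ * k w ∂ν := by
  have hprod := integrable_prod_cauchy hm hi hC hk hki
  have hbd : ∀ᵐ w ∂ν, ‖(w - z)⁻¹‖ ≤ δ⁻¹ := by
    filter_upwards [hz] with w hw
    rw [norm_inv]
    gcongr
  have hG : Integrable (fun p : ℂ × ℂ => (p.1 - z)⁻¹ * (k p.1 * (h p.2 * (p.2 - p.1)⁻¹)))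
      (ν.prod volume) := by
    refine hprod.bdd_mul (c := δ⁻¹)
      ((measurable_fst.sub_const z).inv.aestronglyMeasurable) ?_
    exact Measure.quasiMeasurePreserving_fst.ae hbd
  have hG2 : Integrable (fun p : ℂ × ℂ => ((p.1 - z)⁻¹ * k p.1) * (h p.2 * (p.2 - z)⁻¹))
      (ν.prod volume) :=
    (hki.bdd_mul (c := δ⁻¹) ((measurable_id.sub_const z).inv.aestronglyMeasurable) hbd).mul_prod
      (integrable_mul_cauchy hm hi hC z)
  have hae : ∀ᵐ p ∂(ν.prod (volume : Measure ℂ)),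
      (p.1 - z)⁻¹ * (k p.1 * (h p.2 * (p.2 - p.1)⁻¹)) -
        ((p.1 - z)⁻¹ * k p.1) * (h p.2 * (p.2 - z)⁻¹) =
      -((p.2 - z)⁻¹ * (h p.2 * ((p.1 - p.2)⁻¹ * k p.1))) := by
    have hdiag : ∀ᵐ p ∂(ν.prod (volume : Measure ℂ)), p.2 ≠ p.1 := by
      have hs : MeasurableSet {p : ℂ × ℂ | p.2 ≠ p.1} :=
        (measurableSet_eq_fun measurable_snd measurable_fst).compl
      rw [Measure.ae_prod_iff_ae_ae hs]
      exact Eventually.of_forall fun w => Measure.ae_ne volume w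
    filter_upwards [hdiag, Measure.quasiMeasurePreserving_fst.ae hz,
      Measure.quasiMeasurePreserving_snd.ae (Measure.ae_ne volume z)] with p h1 h2 h3
    have e1 : p.2 - p.1 ≠ 0 := sub_ne_zero.mpr h1
    have e1' : p.1 - p.2 ≠ 0 := sub_ne_zero.mpr h1.symm
    have e2 : p.1 - z ≠ 0 := norm_pos_iff.mp (hδ.trans_le h2)
    have e3 : p.2 - z ≠ 0 := sub_ne_zero.mpr h3
    rw [← neg_sub p.2 p.1, inv_neg]
    field_simp
    ring
  have hG1 := (hG.sub hG2).congr hae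
  have hsub := integral_sub hG hG2
  rw [integral_congr_ae hae, integral_prod_mul (fun w => (w - z)⁻¹ * k w)
    (fun u => h u * (u - z)⁻¹), integral_prod _ hG, integral_prod_symm _ hG1] at hsub
  simp only [integral_const_mul, integral_neg] at hsub
  rw [mul_comm (∫ u, h u * (u - z)⁻¹)]
  linear_combination -hsub

/-- The radial density on the annulus `r < ‖u - c‖ < R` whose Cauchy transform is `1` inside
and `0` outside. -/
noncomputable def annulusDensity (c : ℂ) (r R : ℝ) (u : ℂ) : ℂ :=
  (ball c R \ closedBall c r).indicator
    (fun u => ((2 * Real.pi * (R - r) : ℝ) : ℂ)⁻¹ * ((u - c) / ‖u - c‖)) u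

lemma measurable_annulusDensity (c : ℂ) (r R : ℝ) : Measurable (annulusDensity c r R) := by
  refine Measurable.indicator ?_ (measurableSet_ball.diff measurableSet_closedBall)
  fun_prop

lemma enorm_annulusDensity_le (c : ℂ) (r R : ℝ) (u : ℂ) :
    ‖annulusDensity c r R u‖ₑ ≤ ‖2 * Real.pi * (R - r)‖₊⁻¹ := by
  refine (enorm_indicator_le_enorm_self _ _).trans ?_
  rw [enorm_eq_nnnorm, ENNReal.coe_le_coe, nnnorm_mul, nnnorm_inv, Complex.nnnorm_real]
  refine mul_le_of_le_one_right zero_le ?_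
  rw [← NNReal.coe_le_coe]
  simpa using div_self_le_one _

lemma integrable_annulusDensity (c : ℂ) (r R : ℝ) : Integrable (annulusDensity c r R) := by
  have hs : MeasurableSet (ball c R \ closedBall c r) :=
    measurableSet_ball.diff measurableSet_closedBall
  have hμ : volume (ball c R \ closedBall c r) < ∞ :=
    (measure_mono sdiff_subset).trans_lt measure_ball_lt_top
  have : IntegrableOn (annulusDensity c r R) (ball c R \ closedBall c r) := by
    refine Measure.integrableOn_of_bounded hμ.ne
      (measurable_annulusDensity c r R).aestronglyMeasurable
      (M := ‖2 * Real.pi * (R - r)‖₊⁻¹) (Eventually.of_forall fun u => ?_)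
    have := enorm_annulusDensity_le c r R u
    rw [enorm_eq_nnnorm, ENNReal.coe_le_coe] at this
    exact_mod_cast this
  refine (integrableOn_iff_integrable_of_support_subset ?_).mp this
  exact support_indicator_subset

lemma annulusDensity_eq_zero {c : ℂ} {r R : ℝ} {u : ℂ} (hu : u ∉ closedBall c R) :
    annulusDensity c r R u = 0 :=
  indicator_of_notMem (fun h => hu (ball_subset_closedBall h.1)) _

lemma integral_polar_kernel (c z : ℂ) (ρ : ℝ) :
    ∫ θ in Ioo (-Real.pi) Real.pi, circleMap 0 ρ θ * (circleMap 0 ρ θ + (c - z))⁻¹ =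
      -I * ∮ u in C(c, ρ), (u - z)⁻¹ := by
  have hper : Function.Periodic
      (fun θ => circleMap 0 ρ θ * (circleMap 0 ρ θ + (c - z))⁻¹) (2 * Real.pi) := fun θ => by
    simp only [periodic_circleMap 0 ρ θ]
  rw [← integral_Ioc_eq_integral_Ioo, ← intervalIntegral.integral_of_le (by linarith [Real.pi_pos])]
  have := hper.intervalIntegral_add_eq (-Real.pi) 0
  rw [show -Real.pi + 2 * Real.pi = Real.pi by ring, zero_add] at this
  rw [this, circleIntegral, ← intervalIntegral.integral_const_mul]
  congr 1
  ext θ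
  simp only [deriv_circleMap, smul_eq_mul]
  rw [show circleMap c ρ θ = circleMap 0 ρ θ + c by simp [circleMap, add_comm], add_sub_assoc]
  linear_combination (circleMap 0 ρ θ * (circleMap 0 ρ θ + (c - z))⁻¹) * I_mul_I

lemma integrableOn_polar {f : ℂ → ℂ} (hm : Measurable f) (hf : Integrable f) :
    IntegrableOn (fun p : ℝ × ℝ => p.1 • f (Complex.polarCoord.symm p)) polarCoord.target := by
  have hmp : Measurable fun p : ℝ × ℝ => Complex.polarCoord.symm p := by
    simp only [Complex.polarCoord_symm_apply]
    fun_prop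
  refine ⟨(measurable_fst.smul (hm.comp hmp)).aestronglyMeasurable, ?_⟩
  have h2 := hf.2
  rw [HasFiniteIntegral, ← Complex.lintegral_comp_polarCoord_symm] at h2
  rw [HasFiniteIntegral]
  convert h2 using 1
  refine setLIntegral_congr_fun polarCoord.open_target.measurableSet fun p hp => ?_
  have : 0 < p.1 := hp.1
  simp only [enorm_smul, smul_eq_mul]
  rw [Real.enorm_eq_ofReal this.le]

lemma polarCoord_symm_eq_circleMap (ρ θ : ℝ) :
    Complex.polarCoord.symm (ρ, θ) = circleMap 0 ρ θ := by
  rw [Complex.polarCoord_symm_apply, circleMap, Complex.exp_mul_I]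
  simp

lemma integral_annulusDensity_cauchy {c : ℂ} {r R : ℝ} (hr : 0 < r) (z A : ℂ)
    (hA : ∀ ρ ∈ Ioo r R, ∮ u in C(c, ρ), (u - z)⁻¹ = A)
    (hi : Integrable fun u => annulusDensity c r R u * (u - z)⁻¹) (hrR : r < R) :
    ∫ u, annulusDensity c r R u * (u - z)⁻¹ = -I * A / (2 * Real.pi) := by
  have hm : Measurable fun u => annulusDensity c r R (u + c) * (u + c - z)⁻¹ := by
    have := measurable_annulusDensity c r R
    fun_prop
  have hpol := integrableOn_polar hm (hi.comp_add_right c)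
  rw [← integral_add_right_eq_self _ c, ← Complex.integral_comp_polarCoord_symm]
  simp only [polarCoord_target] at hpol ⊢
  rw [Measure.volume_eq_prod] at hpol ⊢
  rw [setIntegral_prod _ hpol]
  have hinner : ∀ ρ ∈ Ioi (0 : ℝ), ∫ θ in Ioo (-Real.pi) Real.pi,
      ρ • (annulusDensity c r R (Complex.polarCoord.symm (ρ, θ) + c) *
        (Complex.polarCoord.symm (ρ, θ) + c - z)⁻¹) =
      (Ioo r R).indicator
        (fun _ => ((2 * Real.pi * (R - r) : ℝ) : ℂ)⁻¹ * (-I * A)) ρ := by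
    intro ρ hρ
    have hρ' : 0 < ρ := hρ
    simp only [polarCoord_symm_eq_circleMap]
    by_cases hρr : ρ ∈ Ioo r R
    · rw [indicator_of_mem hρr, ← hA ρ hρr, ← integral_polar_kernel, ← integral_const_mul]
      congr 1
      ext θ
      have hmem : circleMap 0 ρ θ + c ∈ ball c R \ closedBall c r := by
        simp [abs_of_pos hρ', hρr.1, hρr.2]
      rw [annulusDensity, indicator_of_mem hmem]
      simp only [add_sub_cancel_right, norm_circleMap_zero, abs_of_pos hρ', real_smul]
      have : (ρ : ℂ) ≠ 0 := by exact_mod_cast hρ'.ne'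
      rw [add_sub_assoc]
      field_simp
    · rw [indicator_of_notMem hρr]
      refine integral_eq_zero_of_ae (Eventually.of_forall fun θ => ?_)
      have hmem : circleMap 0 ρ θ + c ∉ ball c R \ closedBall c r := by
        simp only [Set.mem_sdiff, mem_ball, dist_add_self_left, norm_circleMap_zero, abs_of_pos hρ',
          mem_closedBall, not_le]
        exact fun h => hρr ⟨h.2, h.1⟩
      have : annulusDensity c r R (circleMap 0 ρ θ + c) = 0 := indicator_of_notMem hmem _
      simp [this]
  rw [setIntegral_congr_fun measurableSet_Ioi hinner, setIntegral_indicator measurableSet_Ioo,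
    inter_eq_right.mpr (show Ioo r R ⊆ Ioi 0 from fun ρ hρ => hr.trans hρ.1), setIntegral_const]
  have h1 : (R : ℂ) - r ≠ 0 := by exact_mod_cast (sub_pos.mpr hrR).ne'
  have h2 : (Real.pi : ℂ) ≠ 0 := by exact_mod_cast Real.pi_ne_zero
  simp only [Measure.real, Real.volume_Ioo, real_smul,
    ENNReal.toReal_ofReal (sub_pos.mpr hrR).le]
  push_cast
  field_simp

lemma integral_annulusDensity_cauchy_of_mem {c z : ℂ} {r R : ℝ} (hr : 0 < r) (hrR : r < R)
    (hz : z ∈ ball c r) (hi : Integrable fun u => annulusDensity c r R u * (u - z)⁻¹) :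
    ∫ u, annulusDensity c r R u * (u - z)⁻¹ = 1 := by
  rw [integral_annulusDensity_cauchy hr z (2 * Real.pi * I) (fun ρ hρ =>
    circleIntegral.integral_sub_inv_of_mem_ball (ball_subset_ball hρ.1.le hz)) hi hrR]
  have h2 : (Real.pi : ℂ) ≠ 0 := by exact_mod_cast Real.pi_ne_zero
  field_simp
  simp

lemma integral_annulusDensity_cauchy_of_notMem {c z : ℂ} {r R : ℝ} (hr : 0 < r) (hrR : r < R)
    (hz : z ∉ closedBall c R) (hi : Integrable fun u => annulusDensity c r R u * (u - z)⁻¹) :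
    ∫ u, annulusDensity c r R u * (u - z)⁻¹ = 0 := by
  rw [integral_annulusDensity_cauchy hr z 0 ?_ hi hrR]
  · simp
  intro ρ hρ
  have hd : ∀ u ∈ closedBall c ρ, u - z ≠ 0 := fun u hu h =>
    hz (closedBall_subset_closedBall hρ.2.le (sub_eq_zero.mp h ▸ hu))
  refine Complex.circleIntegral_eq_zero_of_differentiable_on_off_countable (hr.trans hρ.1).le
    countable_empty (ContinuousOn.inv₀ (by fun_prop) hd) fun u hu => ?_
  exact DifferentiableAt.inv (by fun_prop) (hd u (ball_subset_closedBall hu.1))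

/-- Integration of continuous functions on the compact set `L` against `k dm`. -/
lemma exists_integral_clm {L : Set ℂ} [CompactSpace L] (hL : MeasurableSet L) {m : Measure ℂ}
    {k : ℂ → ℂ} (hk : Integrable k m) :
    ∃ Λ : C(L, ℂ) →L[ℂ] ℂ, ∀ (f : ℂ → ℂ) (g : C(L, ℂ)), (∀ w : L, g w = f w) →
      Λ g = ∫ w in L, f w * k w ∂m := by
  have hk' : Integrable (fun w : L => k w) (Measure.comap Subtype.val m) := by
    have := hk.integrableOn (s := L)
    rw [IntegrableOn, ← map_comap_subtype_coe hL,
      (MeasurableEmbedding.subtype_coe hL).integrable_map_iff] at this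
    exact this
  have hi (g : C(L, ℂ)) : Integrable (fun w : L => g w * k w) (Measure.comap Subtype.val m) :=
    hk'.bdd_mul (c := ‖g‖) g.continuous.measurable.aestronglyMeasurable
      (Eventually.of_forall g.norm_coe_le_norm)
  let Λ : C(L, ℂ) →ₗ[ℂ] ℂ :=
    { toFun g := ∫ w : L, g w * k w ∂(Measure.comap Subtype.val m)
      map_add' f g := by
        simp only [ContinuousMap.add_apply, add_mul]
        exact integral_add (hi f) (hi g)
      map_smul' a g := by
        simp only [ContinuousMap.smul_apply, smul_eq_mul, mul_assoc, integral_const_mul,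
          RingHom.id_apply] }
  refine ⟨Λ.mkContinuous (∫ w : L, ‖k w‖ ∂(Measure.comap Subtype.val m)) fun g => ?_,
    fun f g hfg => ?_⟩
  · rw [mul_comm, ← integral_const_mul]
    refine norm_integral_le_of_norm_le (hk'.norm.const_mul _) (Eventually.of_forall fun w => ?_)
    rw [norm_mul]
    gcongr
    exact g.norm_coe_le_norm w
  · rw [← integral_subtype_comap hL fun w => f w * k w]
    exact integral_congr_ae (Eventually.of_forall fun w => by simp only [hfg w])

/-- A functional on `C(L)` that annihilates the Cauchy kernels with poles in a dense set
annihilates all continuous functions when `L` is a C-compact. -/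
lemma IsCCompact.eq_zero_of_cauchyKernel {L : Set ℂ} [CompactSpace L] (h : IsCCompact L)
    (Λ : C(L, ℂ) →L[ℂ] ℂ) {D : Set ℂ} (hD : Dense D)
    (hΛ : ∀ z : (Lᶜ : Set ℂ), (z : ℂ) ∈ D → Λ (cauchyKernel L z) = 0) (f : C(ℂ, ℂ)) :
    Λ (f.restrict L) = 0 := by
  have hall : ∀ z, Λ (cauchyKernel L z) = 0 := by
    have hcl : IsClosed {z : (Lᶜ : Set ℂ) | Λ (cauchyKernel L z) = 0} :=
      isClosed_eq (Λ.continuous.comp (cauchyKernel L).continuous) continuous_const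
    have hd := hD.preimage h.1.isClosed.isOpen_compl.isOpenMap_subtype_val
    exact fun z => closure_minimal hΛ hcl (hd z)
  have hker : cauchySpan L ≤ LinearMap.ker Λ.toLinearMap := by
    refine Submodule.topologicalClosure_minimal _ (Submodule.span_le.mpr ?_) Λ.isClosed_ker
    rintro _ ⟨z, rfl⟩
    exact hall z
  exact hker (h.restrict_mem_cauchySpan f)

lemma CMeasure.integrable_density (μ : CMeasure) : Integrable μ.density μ.var := by
  have := μ.finite
  exact Integrable.of_bound μ.meas_density.aestronglyMeasurable 1
    (μ.norm_density.mono fun w hw => hw.le)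

lemma CMeasure.var_ball_eq_zero {K : Set ℂ} (hK : IsCompact K) (hKint : interior K = ∅)
    (μ : CMeasure) (hsupp : μ.SupportedIn K) {W : Set ℂ}
    (hCC : IsCCompact (K ∩ closure W)) (hvan : ∀ z ∈ W \ K, μ.cauchy z = 0)
    {c : ℂ} {r R : ℝ} (hr : 0 < r) (hrR : r < R) (hcW : closedBall c R ⊆ W) :
    μ.var (ball c r) = 0 := by
  have := μ.finite
  have hμK : ∀ᵐ w ∂μ.var, w ∈ K := measure_eq_zero_iff_ae_notMem.mp hsupp |>.mono fun w hw =>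
    not_not.mp hw
  set L := K ∩ closure W
  have hLc : CompactSpace L := isCompact_iff_compactSpace.mp hCC.1
  have hLm : MeasurableSet L := hCC.1.measurableSet
  set h := annulusDensity c r R with hh
  have hm : Measurable h := measurable_annulusDensity c r R
  have hi : Integrable h := integrable_annulusDensity c r R
  have hC := enorm_annulusDensity_le c r R
  have hik := integrable_mul_cauchy hm hi hC
  set φ : ℂ → ℂ := fun w => ∫ u, h u * (u - w)⁻¹
  have hφ0 : ∀ w, w ∉ closedBall c R → φ w = 0 := fun w hw =>
    integral_annulusDensity_cauchy_of_notMem hr hrR hw (hik w)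
  have hφ1 : ∀ w ∈ ball c r, φ w = 1 := fun w hw =>
    integral_annulusDensity_cauchy_of_mem hr hrR hw (hik w)
  have hprod := integrable_prod_cauchy hm hi hC μ.meas_density μ.integrable_density
  have hk1 : Integrable (fun w => μ.density w * φ w) μ.var := by
    simpa only [integral_const_mul] using hprod.integral_prod_left
  have hk2 : Integrable (fun u => h u * μ.cauchy u) := by
    refine hprod.integral_prod_right.neg.congr (Eventually.of_forall fun u => ?_)
    simp only [Pi.neg_apply]
    rw [CMeasure.cauchy, ← integral_const_mul, ← integral_neg]
    refine integral_congr_ae (Eventually.of_forall fun w => ?_)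
    simp only
    rw [← neg_sub u w, inv_neg]
    ring
  have hLmem : ∀ w ∈ K, w ∉ L → w ∉ closedBall c R := fun w hw hwL hwc =>
    hwL ⟨hw, subset_closure (hcW hwc)⟩
  obtain ⟨Λ₁, hΛ₁⟩ := exists_integral_clm hLm hk1
  obtain ⟨Λ₂, hΛ₂⟩ := exists_integral_clm hLm hk2
  have hdense : Dense Kᶜ := interior_eq_empty_iff_dense_compl.mp hKint
  have hΛ : ∀ z : (Lᶜ : Set ℂ), (z : ℂ) ∈ Kᶜ → (Λ₁ + Λ₂) (cauchyKernel L z) = 0 := by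
    intro z hz
    obtain ⟨δ, hδ, hball⟩ := Metric.isOpen_iff.mp hK.isClosed.isOpen_compl z hz
    have hdist : ∀ᵐ w ∂μ.var, δ ≤ ‖w - (z : ℂ)‖ := hμK.mono fun w hw => by
      by_contra! hlt
      exact hball (mem_ball_iff_norm.mpr hlt) hw
    have key := cauchy_localization hm hi hC μ.meas_density μ.integrable_density hδ hdist
    have hzero : φ z * μ.cauchy z = 0 := by
      by_cases hzW : (z : ℂ) ∈ W
      · rw [hvan z ⟨hzW, hz⟩, mul_zero]
      · rw [hφ0 z fun h => hzW (hcW h), zero_mul]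
    rw [add_apply, hΛ₁ (fun w => (w - z)⁻¹) _ fun w => rfl,
      hΛ₂ (fun w => (w - z)⁻¹) _ fun w => rfl,
      setIntegral_eq_integral_of_ae_compl_eq_zero, setIntegral_eq_integral_of_ae_compl_eq_zero]
    · exact key.trans hzero
    · refine Eventually.of_forall fun u hu => ?_
      by_cases huc : u ∈ closedBall c R
      · have huK : u ∉ K := fun huK => hLmem u huK hu huc
        rw [hvan u ⟨hcW huc, huK⟩]
        simp
      · rw [hh, annulusDensity_eq_zero huc]
        simp
    · filter_upwards [hμK] with w hw hwL
      rw [hφ0 w (hLmem w hw hwL)]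
      simp
  have htest : ∀ g : ℂ → ℝ, ContDiff ℝ ((⊤ : ℕ∞) : WithTop ℕ∞) g → HasCompactSupport g →
      tsupport g ⊆ ball c r → ∫ w, g w • μ.density w ∂μ.var = 0 := by
    intro g hg _ hgs
    have hg0 : ∀ w, w ∉ ball c r → g w = 0 := fun w hw =>
      image_eq_zero_of_notMem_tsupport fun h => hw (hgs h)
    let f : C(ℂ, ℂ) := ⟨fun w => (g w : ℂ), continuous_ofReal.comp hg.continuous⟩
    have hf := hCC.eq_zero_of_cauchyKernel (Λ₁ + Λ₂) hdense hΛ f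
    rw [add_apply, hΛ₁ f _ fun w => rfl, hΛ₂ f _ fun w => rfl] at hf
    have h2 : ∀ u, f u * (h u * μ.cauchy u) = 0 := by
      intro u
      by_cases hu : u ∈ ball c r
      · have : h u = 0 := indicator_of_notMem (fun hu' => hu'.2 (ball_subset_closedBall hu)) _
        rw [this]
        simp
      · have : f u = 0 := by simp [f, hg0 u hu]
        rw [this, zero_mul]
    have h1 : ∀ w, f w * (μ.density w * φ w) = g w • μ.density w := by
      intro w
      by_cases hw : w ∈ ball c r
      · rw [hφ1 w hw, mul_one, real_smul]
        rfl
      · simp [f, hg0 w hw]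
    simp only [h1, h2, integral_zero, add_zero] at hf
    rwa [setIntegral_eq_integral_of_ae_compl_eq_zero] at hf
    filter_upwards [hμK] with w hw hwL
    rw [hg0 w fun hwb => hLmem w hw hwL (ball_subset_closedBall (ball_subset_ball hrR.le hwb)),
      zero_smul]
  have hae := isOpen_ball.ae_eq_zero_of_integral_contDiff_smul_eq_zero
    (μ.integrable_density.locallyIntegrable.locallyIntegrableOn _) htest
  refine measure_eq_zero_iff_ae_notMem.mpr ?_
  filter_upwards [hae, μ.norm_density] with w hw hw1 hwb
  rw [hw hwb, norm_zero] at hw1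
  exact zero_ne_one hw1

/-- Local removability of C-compacts: if `K ∩ closure W` is a C-compact for an open
neighborhood `W` of `x ∈ K` and the Cauchy transform of `μ` vanishes on `W \ K`, then
the total variation of `μ` vanishes on `W`. -/
theorem local_vanishing (K : Set ℂ) (hK : IsCompact K) (hKint : interior K = ∅)
    (μ : CMeasure) (hsupp : μ.SupportedIn K)
    (x : ℂ) (hxK : x ∈ K) (W : Set ℂ) (hW : IsOpen W) (hxW : x ∈ W)
    (hCC : IsCCompact (K ∩ closure W))
    (hvan : ∀ z ∈ W \ K, μ.cauchy z = 0) :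
    μ.var W = 0 := by
  refine measure_null_of_locally_null W fun c hc => ?_
  obtain ⟨R, hR, hball⟩ := Metric.nhds_basis_closedBall.mem_iff.mp (hW.mem_nhds hc)
  exact ⟨ball c (R / 2), mem_nhdsWithin_of_mem_nhds (ball_mem_nhds c (half_pos hR)),
    μ.var_ball_eq_zero hK hKint hsupp hCC hvan (half_pos hR) (half_lt_self hR) hball⟩
end
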